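/- arXiv:1410.5298 — 12 statements merged into one kernel-verified Lean document; each statement's English description precedes it below -/
import Mathlib

section
/- Let V be a finite-dimensional real vector space and L ⊆ V × V* a maximally isotropic subspace. Then the projection V × V* → V maps L onto V if and only if there exists an alternating linear map ω : V → V* such that L = {(X, ωX) : X ∈ V}. Moreover, for every alternating linear map ω : V → V*, the graph {(X, ωX) : X ∈ V} is a maximally isotropic subspace of V × V*. -/
/-- The graph of a linear map has the same rank as its domain. -/
theorem LinearMap.finrank_graph_eq {K V W : Type*} [DivisionRing K] [AddCommGroup V] [Module K V]
    [AddCommGroup W] [Module K W] (f : V →ₗ[K] W) :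
    Module.finrank K f.graph = Module.finrank K V := by
  rw [LinearMap.graph_eq_range_prod]
  exact LinearMap.finrank_range_of_inj fun x y h => congrArg Prod.fst h

/-- A subspace of `V × W` of the same dimension as `V` that projects onto `V` is the graph of a
linear map. -/
theorem Submodule.exists_eq_graph_of_map_fst_eq_top {K V W : Type*} [DivisionRing K]
    [AddCommGroup V] [Module K V] [FiniteDimensional K V] [AddCommGroup W] [Module K W]
    [FiniteDimensional K W] {L : Submodule K (V × W)}
    (hL : L.map (LinearMap.fst K V W) = ⊤) (hdim : Module.finrank K L = Module.finrank K V) :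
    ∃ f : V →ₗ[K] W, L = f.graph := by
  let p : L →ₗ[K] V := LinearMap.fst K V W ∘ₗ L.subtype
  have hsurj : Function.Surjective p := by
    rw [← LinearMap.range_eq_top, LinearMap.range_comp, Submodule.range_subtype, hL]
  have hinj : Function.Injective p :=
    (LinearMap.injective_iff_surjective_of_finrank_eq_finrank hdim).2 hsurj
  let e := LinearEquiv.ofBijective p ⟨hinj, hsurj⟩
  refine ⟨LinearMap.snd K V W ∘ₗ L.subtype ∘ₗ e.symm.toLinearMap, ?_⟩
  refine Submodule.eq_of_le_of_finrank_eq (fun a ha => ?_) ?_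
  · have h : e.symm a.1 = ⟨a, ha⟩ := e.symm_apply_eq.2 rfl
    simp [LinearMap.mem_graph_iff, h]
  · rw [hdim, LinearMap.finrank_graph_eq]


/-- A maximally isotropic subspace `L ⊆ V × V*` projects onto `V`
iff it is the graph of an alternating linear map `ω : V → V*`; moreover the graph of
every alternating linear map `ω : V → V*` is maximally isotropic. -/
theorem stmt_0 (V : Type*) [AddCommGroup V] [Module ℝ V] [FiniteDimensional ℝ V]
    (L : Submodule ℝ (V × Module.Dual ℝ V))
    (hiso : ∀ a ∈ L, ∀ b ∈ L, (1 / 2 : ℝ) * (b.2 a.1 + a.2 b.1) = 0)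
    (hmax : Module.finrank ℝ L = Module.finrank ℝ V) :
    (Submodule.map (LinearMap.fst ℝ V (Module.Dual ℝ V)) L = ⊤ ↔
      ∃ ω : V →ₗ[ℝ] Module.Dual ℝ V, (∀ X, ω X X = 0) ∧ L = LinearMap.graph ω) ∧
    ∀ ω : V →ₗ[ℝ] Module.Dual ℝ V, (∀ X, ω X X = 0) →
      ((∀ a ∈ LinearMap.graph ω, ∀ b ∈ LinearMap.graph ω,
          (1 / 2 : ℝ) * (b.2 a.1 + a.2 b.1) = 0) ∧
        Module.finrank ℝ (LinearMap.graph ω) = Module.finrank ℝ V) := by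
  refine ⟨⟨fun h => ?_, ?_⟩, fun ω hω => ⟨?_, ω.finrank_graph_eq⟩⟩
  · obtain ⟨ω, rfl⟩ := Submodule.exists_eq_graph_of_map_fst_eq_top h hmax
    refine ⟨ω, fun X => ?_, rfl⟩
    have hX : (X, ω X) ∈ ω.graph := (ω.mem_graph_iff _).2 rfl
    have := hiso _ hX _ hX
    dsimp only at this
    linarith
  · rintro ⟨ω, -, rfl⟩
    exact eq_top_iff.2 fun X _ => ⟨(X, ω X), (ω.mem_graph_iff _).2 rfl, rfl⟩
  · intro a ha b hb
    rw [LinearMap.mem_graph_iff] at ha hb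
    have hab := hω (a.1 + b.1)
    simp only [map_add, LinearMap.add_apply, hω] at hab
    rw [ha, hb]
    linarith
end

section
/- Let V be a finite-dimensional real vector space and L ⊆ V × V* a maximally isotropic subspace. Then the following are equivalent: (a) the projection V × V* → V* maps L onto V*; (b) L ∩ (V × {0}) = {0}; (c) there exists an alternating linear map Π : V* → V such that L = {(Πα, α) : α ∈ V*}. Moreover, for every alternating linear map Π : V* → V, the graph {(Πα, α) : α ∈ V*} is a maximally isotropic subspace of V × V*. -/
section

variable {K V W : Type*} [Field K] [AddCommGroup V] [Module K V] [AddCommGroup W] [Module K W]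

theorem map_snd_eq_top_iff_inf_prod_eq_bot [FiniteDimensional K V] [FiniteDimensional K W]
    {L : Submodule K (V × W)} (hL : Module.finrank K L = Module.finrank K W) :
    Submodule.map (LinearMap.snd K V W) L = ⊤ ↔
      L ⊓ Submodule.prod (⊤ : Submodule K V) (⊥ : Submodule K W) = ⊥ := by
  have hker : (⊤ : Submodule K V).prod (⊥ : Submodule K W) = LinearMap.ker (LinearMap.snd K V W) := by
    ext x
    simp [Submodule.mem_prod]
  rw [hker, ← LinearMap.range_domRestrict, LinearMap.range_eq_top,
    ← LinearMap.injective_iff_surjective_of_finrank_eq_finrank hL,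
    LinearMap.injective_domRestrict_iff, disjoint_iff]

theorem exists_eq_range_prod_id {L : Submodule K (V × W)}
    (hsnd : Submodule.map (LinearMap.snd K V W) L = ⊤)
    (hinf : L ⊓ Submodule.prod (⊤ : Submodule K V) (⊥ : Submodule K W) = ⊥) :
    ∃ P : W →ₗ[K] V, L = LinearMap.range (P.prod LinearMap.id) := by
  have hsurj : ∀ w : W, ∃ v : V, (v, w) ∈ L := fun w ↦ by
    obtain ⟨⟨v, _⟩, hx, rfl⟩ : w ∈ L.map (LinearMap.snd K V W) := hsnd ▸ Submodule.mem_top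
    exact ⟨v, hx⟩
  have huniq : ∀ {v v' : V} {w : W}, (v, w) ∈ L → (v', w) ∈ L → v = v' := fun {v v' w} h h' ↦ by
    have hmem : (v, w) - (v', w) ∈ L ⊓ Submodule.prod (⊤ : Submodule K V) (⊥ : Submodule K W) :=
      ⟨L.sub_mem h h', by simp⟩
    rw [hinf, Submodule.mem_bot, sub_eq_zero] at hmem
    exact congrArg Prod.fst hmem
  choose p hp using hsurj
  refine ⟨{ toFun := p
            map_add' := fun x y ↦ huniq (hp _) (L.add_mem (hp x) (hp y))
            map_smul' := fun c x ↦ huniq (hp _) (L.smul_mem c (hp x)) }, ?_⟩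
  ext ⟨v, w⟩
  constructor
  · exact fun h ↦ ⟨w, Prod.ext (huniq (hp w) h) rfl⟩
  · rintro ⟨w', h⟩
    exact h ▸ hp w'

theorem map_snd_range_prod_id (P : W →ₗ[K] V) :
    Submodule.map (LinearMap.snd K V W) (LinearMap.range (P.prod LinearMap.id)) = ⊤ := by
  rw [← LinearMap.range_comp, LinearMap.snd_prod, LinearMap.range_id]

theorem finrank_range_prod_id (P : W →ₗ[K] V) :
    Module.finrank K (LinearMap.range (P.prod LinearMap.id)) = Module.finrank K W :=
  LinearMap.finrank_range_of_inj fun _ _ h ↦ congrArg Prod.snd h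

theorem dual_apply_add_swap_eq_zero {P : Module.Dual K V →ₗ[K] V}
    (hP : ∀ α : Module.Dual K V, α (P α) = 0) (α β : Module.Dual K V) :
    β (P α) + α (P β) = 0 := by
  have h := hP (α + β)
  simp only [map_add, LinearMap.add_apply, hP] at h
  linear_combination h

end


/-- For a maximally isotropic subspace `L ⊆ V × V*` the following
are equivalent: (a) `L` projects onto `V*`; (b) `L ∩ (V × {0}) = 0`; (c) `L` is the
graph `{(Pα, α)}` of an alternating linear map `P : V* → V`. Moreover the graph of
every alternating `P : V* → V` is maximally isotropic. -/
theorem stmt_1 (V : Type*) [AddCommGroup V] [Module ℝ V] [FiniteDimensional ℝ V]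
    (L : Submodule ℝ (V × Module.Dual ℝ V))
    (hiso : ∀ a ∈ L, ∀ b ∈ L, (1 / 2 : ℝ) * (b.2 a.1 + a.2 b.1) = 0)
    (hmax : Module.finrank ℝ L = Module.finrank ℝ V) :
    ((Submodule.map (LinearMap.snd ℝ V (Module.Dual ℝ V)) L = ⊤ ↔
        L ⊓ Submodule.prod (⊤ : Submodule ℝ V) (⊥ : Submodule ℝ (Module.Dual ℝ V)) = ⊥) ∧
      (Submodule.map (LinearMap.snd ℝ V (Module.Dual ℝ V)) L = ⊤ ↔
        ∃ P : Module.Dual ℝ V →ₗ[ℝ] V, (∀ α : Module.Dual ℝ V, α (P α) = 0) ∧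
          L = LinearMap.range (P.prod LinearMap.id))) ∧
    ∀ P : Module.Dual ℝ V →ₗ[ℝ] V, (∀ α : Module.Dual ℝ V, α (P α) = 0) →
      ((∀ a ∈ LinearMap.range (P.prod LinearMap.id),
          ∀ b ∈ LinearMap.range (P.prod LinearMap.id),
          (1 / 2 : ℝ) * (b.2 a.1 + a.2 b.1) = 0) ∧
        Module.finrank ℝ (LinearMap.range (P.prod LinearMap.id)) = Module.finrank ℝ V) := by
  have hdual : Module.finrank ℝ (Module.Dual ℝ V) = Module.finrank ℝ V :=
    Subspace.dual_finrank_eq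
  have hab := map_snd_eq_top_iff_inf_prod_eq_bot (hmax.trans hdual.symm)
  refine ⟨⟨hab, fun ha ↦ ?_, ?_⟩, fun P hP ↦ ⟨?_, (finrank_range_prod_id P).trans hdual⟩⟩
  · obtain ⟨P, rfl⟩ := exists_eq_range_prod_id ha (hab.mp ha)
    refine ⟨P, fun α ↦ ?_, rfl⟩
    have h : (1 / 2 : ℝ) * (α (P α) + α (P α)) = 0 := hiso _ ⟨α, rfl⟩ _ ⟨α, rfl⟩
    linarith
  · rintro ⟨P, -, rfl⟩
    exact map_snd_range_prod_id P
  · rintro _ ⟨α, rfl⟩ _ ⟨β, rfl⟩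
    exact mul_eq_zero_of_right _ (dual_apply_add_swap_eq_zero hP α β)
end

section
/- Let V be a finite-dimensional real vector space and L ⊆ V × V* a maximally isotropic subspace. Then the image of L under the projection V × V* → V* equals the annihilator of L ∩ (V × {0}); that is, pr_{V*}(L) = {α ∈ V* : α(X) = 0 for every X ∈ V with (X,0) ∈ L}. -/
open Module in
/-- Rank-nullity for the second projection restricted to a subspace of a product. -/
theorem finrank_map_snd_add_finrank_comap_inl {K V W : Type*} [Field K] [AddCommGroup V]
    [Module K V] [AddCommGroup W] [Module K W] [FiniteDimensional K V] [FiniteDimensional K W]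
    (L : Submodule K (V × W)) :
    finrank K (L.map (LinearMap.snd K V W)) + finrank K (L.comap (LinearMap.inl K V W)) =
      finrank K L := by
  have hker : (LinearMap.ker ((LinearMap.snd K V W).domRestrict L)).map L.subtype =
      (L.comap (LinearMap.inl K V W)).map (LinearMap.inl K V W) := by
    ext ⟨x, y⟩
    simp only [Submodule.mem_map, LinearMap.mem_ker, Submodule.mem_comap]
    constructor
    · rintro ⟨⟨⟨x, y⟩, hL⟩, rfl : y = 0, h⟩
      exact ⟨x, hL, h⟩
    · rintro ⟨x, hL, h⟩
      exact ⟨⟨(x, 0), hL⟩, rfl, h⟩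
  rw [← LinearMap.finrank_range_add_finrank_ker ((LinearMap.snd K V W).domRestrict L),
    LinearMap.range_domRestrict,
    (Submodule.equivMapOfInjective _ L.injective_subtype _).finrank_eq, hker,
    (Submodule.equivMapOfInjective (LinearMap.inl K V W) LinearMap.inl_injective _).finrank_eq]

/-- For a maximally isotropic subspace `L ⊆ V × V*`, the image of
`L` under the projection to `V*` equals the annihilator of `L ∩ (V × {0})`. -/
theorem stmt_2 (V : Type*) [AddCommGroup V] [Module ℝ V] [FiniteDimensional ℝ V]
    (L : Submodule ℝ (V × Module.Dual ℝ V))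
    (hiso : ∀ a ∈ L, ∀ b ∈ L, (1 / 2 : ℝ) * (b.2 a.1 + a.2 b.1) = 0)
    (hmax : Module.finrank ℝ L = Module.finrank ℝ V) :
    (Submodule.map (LinearMap.snd ℝ V (Module.Dual ℝ V)) L : Set (Module.Dual ℝ V)) =
      {α : Module.Dual ℝ V | ∀ X : V, (X, (0 : Module.Dual ℝ V)) ∈ L → α X = 0} := by
  have hle : L.map (LinearMap.snd ℝ V (Module.Dual ℝ V)) ≤
      (L.comap (LinearMap.inl ℝ V (Module.Dual ℝ V))).dualAnnihilator := by
    rintro _ ⟨a, ha, rfl⟩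
    rw [Submodule.mem_dualAnnihilator]
    intro X hX
    simpa using hiso a ha (X, 0) hX
  have hrank := finrank_map_snd_add_finrank_comap_inl L
  have hann := Subspace.finrank_add_finrank_dualAnnihilator_eq
    (L.comap (LinearMap.inl ℝ V (Module.Dual ℝ V)))
  rw [Submodule.eq_of_le_of_finrank_eq hle (by omega)]
  ext α
  exact Submodule.mem_dualAnnihilator α
end

section
/- Let ω be an alternating bilinear form on the finite-dimensional real vector space V. Then for every (X,α) ∈ V × V* one has (X,α)·e^{−ω̂} = 0 if and only if α = ω(X,·). Consequently Ann(e^{−ω̂}) = {(X, ω(X,·)) : X ∈ V}, the graph of ω. -/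
set_option synthInstance.maxHeartbeats 1000000

/-- `e^{-ω̂} = Σ_{k=0}^{⌊dim V/2⌋} (-1)^k ω̂^k / k!` in the exterior algebra. -/
noncomputable def expNegTwoForm (V : Type*) [AddCommGroup V] [Module ℝ V]
    [FiniteDimensional ℝ V] (ωhat : ExteriorAlgebra ℝ (Module.Dual ℝ V)) :
    ExteriorAlgebra ℝ (Module.Dual ℝ V) :=
  ∑ k ∈ Finset.range (Module.finrank ℝ V / 2 + 1),
    ((-1 : ℝ) ^ k / (Nat.factorial k : ℝ)) • ωhat ^ k

section TwoForm

open ExteriorAlgebra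

variable {R M : Type*} [CommRing R] [AddCommGroup M] [Module R M]

theorem ExteriorAlgebra.contractLeft_mul_of_mem_sq (d : Module.Dual R M)
    {w : ExteriorAlgebra R M} (hw : w ∈ LinearMap.range (ι R (M := M)) ^ 2)
    (x : ExteriorAlgebra R M) :
    CliffordAlgebra.contractLeft d (w * x) =
      CliffordAlgebra.contractLeft d w * x + w * CliffordAlgebra.contractLeft d x := by
  rw [pow_two] at hw
  induction hw using Submodule.mul_induction_on' with
  | mem_mul_mem a ha b hb =>
    obtain ⟨a, rfl⟩ := ha
    obtain ⟨b, rfl⟩ := hb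
    simp only [ι, mul_assoc, CliffordAlgebra.contractLeft_ι_mul, CliffordAlgebra.contractLeft_ι,
      mul_sub, sub_mul, smul_mul_assoc, mul_smul_comm, Algebra.algebraMap_eq_smul_one,
      mul_one]
    abel
  | add a _ b _ ha hb => simp only [add_mul, map_add, ha, hb]; abel

theorem ExteriorAlgebra.commute_ι_of_mem_sq {w : ExteriorAlgebra R M}
    (hw : w ∈ LinearMap.range (ι R (M := M)) ^ 2) (m : M) : Commute w (ι R m) := by
  rw [pow_two] at hw
  induction hw using Submodule.mul_induction_on' with
  | mem_mul_mem a ha b hb =>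
    obtain ⟨a, rfl⟩ := ha
    obtain ⟨b, rfl⟩ := hb
    have swap (u v : M) : ι R u * ι R v = -(ι R v * ι R u) :=
      eq_neg_of_add_eq_zero_left (ι_add_mul_swap u v)
    rw [Commute, SemiconjBy, mul_assoc, swap b m, mul_neg, ← mul_assoc, swap a m, neg_mul,
      neg_neg, mul_assoc]
  | add a _ b _ ha hb => exact ha.add_left hb

theorem ExteriorAlgebra.contractLeft_pow_succ_of_mem_sq (d : Module.Dual R M)
    {w : ExteriorAlgebra R M} (hw : w ∈ LinearMap.range (ι R (M := M)) ^ 2) {m : M}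
    (hd : CliffordAlgebra.contractLeft d w = ι R m) (k : ℕ) :
    CliffordAlgebra.contractLeft d (w ^ (k + 1)) = ((k + 1 : ℕ) : R) • (ι R m * w ^ k) := by
  induction k with
  | zero => simp [hd]
  | succ k ih =>
    rw [pow_succ' w (k + 1), contractLeft_mul_of_mem_sq d hw, ih, hd, mul_smul_comm, ← mul_assoc,
      (commute_ι_of_mem_sq hw m).eq, mul_assoc, ← pow_succ', Nat.cast_succ (k + 1), add_smul,
      one_smul, add_comm]

end TwoForm

section Field

open ExteriorAlgebra

variable {K M : Type*} [Field K] [AddCommGroup M] [Module K M] [FiniteDimensional K M]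

theorem ExteriorAlgebra.range_ι_pow_eq_bot {n : ℕ} (hn : Module.finrank K M < n) :
    LinearMap.range (ι K (M := M)) ^ n = ⊥ := by
  have h := exteriorPower.finrank_eq (R := K) (M := M) n
  rw [Nat.choose_eq_zero_of_lt hn] at h
  exact Submodule.finrank_eq_zero.mp h

theorem ExteriorAlgebra.pow_eq_zero_of_mem_sq {w : ExteriorAlgebra K M}
    (hw : w ∈ LinearMap.range (ι K (M := M)) ^ 2) :
    w ^ (Module.finrank K M / 2 + 1) = 0 := by
  have h := Submodule.pow_mem_pow _ hw (Module.finrank K M / 2 + 1)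
  rwa [← pow_mul, range_ι_pow_eq_bot (by omega), Submodule.mem_bot] at h

end Field

section Exp

variable {V : Type*} [AddCommGroup V] [Module ℝ V] [FiniteDimensional ℝ V]
  {w : ExteriorAlgebra ℝ (Module.Dual ℝ V)}

theorem isUnit_expNegTwoForm
    (hw : w ∈ LinearMap.range (ExteriorAlgebra.ι ℝ (M := Module.Dual ℝ V)) ^ 2) :
    IsUnit (expNegTwoForm V w) := by
  have hnil : IsNilpotent w := ⟨_, ExteriorAlgebra.pow_eq_zero_of_mem_sq hw⟩
  rw [expNegTwoForm, Finset.sum_range_succ']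
  simp only [pow_zero, Nat.factorial_zero, Nat.cast_one, div_one, one_smul]
  refine IsNilpotent.isUnit_add_one ?_
  simp only [pow_succ w, ← smul_mul_assoc, ← Finset.sum_mul]
  refine Commute.isNilpotent_mul_left ?_ hnil
  exact Commute.sum_left _ _ _ fun k _ => ((Commute.refl w).pow_left k).smul_left _

theorem contractLeft_expNegTwoForm
    (hw : w ∈ LinearMap.range (ExteriorAlgebra.ι ℝ (M := Module.Dual ℝ V)) ^ 2)
    {d : Module.Dual ℝ (Module.Dual ℝ V)} {β : Module.Dual ℝ V}
    (hd : CliffordAlgebra.contractLeft d w = ExteriorAlgebra.ι ℝ β) :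
    CliffordAlgebra.contractLeft d (expNegTwoForm V w) =
      -(ExteriorAlgebra.ι ℝ β * expNegTwoForm V w) := by
  have htop : ExteriorAlgebra.ι ℝ β * w ^ (Module.finrank ℝ V / 2) = 0 := by
    have h := ExteriorAlgebra.contractLeft_pow_succ_of_mem_sq d hw hd (Module.finrank ℝ V / 2)
    have h0 := ExteriorAlgebra.pow_eq_zero_of_mem_sq hw
    rw [Subspace.dual_finrank_eq] at h0
    rw [h0, map_zero] at h
    exact (smul_eq_zero.mp h.symm).resolve_left (Nat.cast_ne_zero.mpr (Nat.succ_ne_zero _))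
  have hR : ExteriorAlgebra.ι ℝ β * expNegTwoForm V w =
      ∑ k ∈ Finset.range (Module.finrank ℝ V / 2),
        ((-1 : ℝ) ^ k / (Nat.factorial k : ℝ)) • (ExteriorAlgebra.ι ℝ β * w ^ k) := by
    rw [expNegTwoForm, Finset.sum_range_succ, mul_add, mul_smul_comm, htop, smul_zero, add_zero,
      Finset.mul_sum]
    simp only [mul_smul_comm]
  rw [hR, expNegTwoForm, Finset.sum_range_succ', map_add, map_sum, ← Finset.sum_neg_distrib]
  simp only [map_smul, pow_zero, CliffordAlgebra.contractLeft_one, smul_zero, add_zero]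
  refine Finset.sum_congr rfl fun k _ => ?_
  rw [ExteriorAlgebra.contractLeft_pow_succ_of_mem_sq d hw hd, smul_smul, ← neg_smul]
  congr 1
  rw [Nat.factorial_succ, Nat.cast_mul, pow_succ]
  field_simp

end Exp

/-- Let `ω` be an alternating bilinear form on `V` (encoded as an
alternating linear map `V → V*`) and let `ω̂` be the corresponding 2-form in `Λ V*`
(degree 2, with `i_X ω̂ = ω(X,·)`). Then `(X,α)·e^{-ω̂} = 0` iff `α = ω(X,·)`;
consequently `Ann(e^{-ω̂})` is the graph of `ω`. -/
theorem stmt_4 (V : Type*) [AddCommGroup V] [Module ℝ V] [FiniteDimensional ℝ V]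
    (ω : V →ₗ[ℝ] Module.Dual ℝ V) (hω : ∀ X, ω X X = 0)
    (ωhat : ExteriorAlgebra ℝ (Module.Dual ℝ V))
    (hgrade : ωhat ∈ (LinearMap.range (ExteriorAlgebra.ι ℝ (M := Module.Dual ℝ V))) ^ 2)
    (hchar : ∀ X : V,
      CliffordAlgebra.contractLeft (Module.Dual.eval ℝ V X) ωhat = ExteriorAlgebra.ι ℝ (ω X)) :
    (∀ (X : V) (α : Module.Dual ℝ V),
      CliffordAlgebra.contractLeft (Module.Dual.eval ℝ V X) (expNegTwoForm V ωhat) +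
          ExteriorAlgebra.ι ℝ α * expNegTwoForm V ωhat = 0 ↔ α = ω X) ∧
    {p : V × Module.Dual ℝ V |
        CliffordAlgebra.contractLeft (Module.Dual.eval ℝ V p.1) (expNegTwoForm V ωhat) +
          ExteriorAlgebra.ι ℝ p.2 * expNegTwoForm V ωhat = 0} =
      (LinearMap.graph ω : Set (V × Module.Dual ℝ V)) := by
  have key (X : V) (α : Module.Dual ℝ V) :
      CliffordAlgebra.contractLeft (Module.Dual.eval ℝ V X) (expNegTwoForm V ωhat) +
          ExteriorAlgebra.ι ℝ α * expNegTwoForm V ωhat = 0 ↔ α = ω X := by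
    rw [contractLeft_expNegTwoForm hgrade (hchar X), neg_add_eq_zero,
      (isUnit_expNegTwoForm hgrade).mul_left_inj, ExteriorAlgebra.ι_inj, eq_comm]
  refine ⟨key, Set.ext fun p => ?_⟩
  rw [Set.mem_ofPred_eq, key, SetLike.mem_coe, LinearMap.mem_graph_iff]
end

section
/- Let ω be an alternating bilinear form on the finite-dimensional real vector space V. Then for every (X,α) ∈ V × V* one has the identity (X,α)·e^{−ω̂} = (α − i_X ω̂) ∧ e^{−ω̂} in Λ V*. -/
set_option synthInstance.maxHeartbeats 1000000

theorem contractLeft_mul_of_mem_range_ι_sq {M : Type*} [AddCommGroup M] [Module ℝ M]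
    (d : Module.Dual ℝ M) {w : ExteriorAlgebra ℝ M}
    (hw : w ∈ (LinearMap.range (ExteriorAlgebra.ι ℝ (M := M))) ^ 2) (b : ExteriorAlgebra ℝ M) :
    CliffordAlgebra.contractLeft d (w * b) =
      CliffordAlgebra.contractLeft d w * b + w * CliffordAlgebra.contractLeft d b := by
  rw [pow_two] at hw
  induction hw using Submodule.mul_induction_on' with
  | mem_mul_mem m hm n hn =>
    obtain ⟨x, rfl⟩ := hm
    obtain ⟨y, rfl⟩ := hn
    simp only [ExteriorAlgebra.ι, mul_assoc, CliffordAlgebra.contractLeft_ι_mul,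
      CliffordAlgebra.contractLeft_ι, Algebra.algebraMap_eq_smul_one, mul_sub, sub_mul,
      smul_mul_assoc, mul_smul_comm, mul_one]
    abel
  | add x _ y _ hx hy =>
    rw [add_mul, map_add, map_add, hx, hy]
    noncomm_ring

theorem commute_ι_of_mem_range_ι_sq {M : Type*} [AddCommGroup M] [Module ℝ M]
    {w : ExteriorAlgebra ℝ M}
    (hw : w ∈ (LinearMap.range (ExteriorAlgebra.ι ℝ (M := M))) ^ 2) (v : M) :
    Commute w (ExteriorAlgebra.ι ℝ v) := by
  rw [pow_two] at hw
  induction hw using Submodule.mul_induction_on' with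
  | mem_mul_mem m hm n hn =>
    obtain ⟨x, rfl⟩ := hm
    obtain ⟨y, rfl⟩ := hn
    have hx := eq_neg_of_add_eq_zero_left (ExteriorAlgebra.ι_add_mul_swap (R := ℝ) x v)
    have hy := eq_neg_of_add_eq_zero_left (ExteriorAlgebra.ι_add_mul_swap (R := ℝ) y v)
    rw [Commute, SemiconjBy, mul_assoc, hy, mul_neg, ← mul_assoc, hx, neg_mul, neg_neg, mul_assoc]
  | add x _ y _ hx hy => exact hx.add_left hy

theorem contractLeft_pow_succ {M : Type*} [AddCommGroup M] [Module ℝ M]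
    (d : Module.Dual ℝ M) {w : ExteriorAlgebra ℝ M}
    (hw : w ∈ (LinearMap.range (ExteriorAlgebra.ι ℝ (M := M))) ^ 2)
    {v : M} (hv : CliffordAlgebra.contractLeft d w = ExteriorAlgebra.ι ℝ v) (k : ℕ) :
    CliffordAlgebra.contractLeft d (w ^ (k + 1)) =
      ((k : ℝ) + 1) • (ExteriorAlgebra.ι ℝ v * w ^ k) := by
  induction k with
  | zero => simp [hv]
  | succ k ih =>
    rw [pow_succ' w (k + 1), contractLeft_mul_of_mem_range_ι_sq d hw, ih, hv, mul_smul_comm,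
      ← mul_assoc, (commute_ι_of_mem_range_ι_sq hw v).eq, mul_assoc, ← pow_succ', Nat.cast_succ,
      add_smul ((k : ℝ) + 1) 1, one_smul, add_comm]

theorem pow_eq_zero_of_mem_range_ι_sq {M : Type*} [AddCommGroup M] [Module ℝ M]
    [FiniteDimensional ℝ M] {w : ExteriorAlgebra ℝ M}
    (hw : w ∈ (LinearMap.range (ExteriorAlgebra.ι ℝ (M := M))) ^ 2) {k : ℕ}
    (hk : Module.finrank ℝ M < 2 * k) : w ^ k = 0 := by
  have hmem : w ^ k ∈ ⋀[ℝ]^(2 * k) M := by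
    rw [ExteriorAlgebra.exteriorPower, pow_mul]
    exact Submodule.pow_mem_pow _ hw k
  have hbot : Module.finrank ℝ (⋀[ℝ]^(2 * k) M) = 0 := by
    rw [exteriorPower.finrank_eq, Nat.choose_eq_zero_of_lt hk]
  rw [Submodule.finrank_eq_zero.mp hbot] at hmem
  exact (Submodule.mem_bot ℝ).mp hmem

/-- The truncated series is differentiated term by term, up to its last term. -/
theorem contractLeft_sum_range_pow {M : Type*} [AddCommGroup M] [Module ℝ M]
    (d : Module.Dual ℝ M) {w : ExteriorAlgebra ℝ M}
    (hw : w ∈ (LinearMap.range (ExteriorAlgebra.ι ℝ (M := M))) ^ 2)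
    {v : M} (hv : CliffordAlgebra.contractLeft d w = ExteriorAlgebra.ι ℝ v) (m : ℕ) :
    CliffordAlgebra.contractLeft d
        (∑ k ∈ Finset.range (m + 1), ((-1 : ℝ) ^ k / (Nat.factorial k : ℝ)) • w ^ k) =
      -(ExteriorAlgebra.ι ℝ v *
        ∑ k ∈ Finset.range m, ((-1 : ℝ) ^ k / (Nat.factorial k : ℝ)) • w ^ k) := by
  rw [Finset.sum_range_succ', map_add, map_sum, Finset.mul_sum, ← Finset.sum_neg_distrib,
    map_smul, pow_zero w, CliffordAlgebra.contractLeft_one, smul_zero, add_zero]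
  refine Finset.sum_congr rfl fun k _ => ?_
  rw [map_smul, contractLeft_pow_succ d hw hv, smul_smul, mul_smul_comm, ← neg_smul]
  congr 1
  rw [Nat.factorial_succ]
  push_cast
  field_simp
  ring

/-- Let `ω` be an alternating bilinear form on `V` and `ω̂` the
corresponding 2-form in `Λ V*` (degree 2, with `i_X ω̂ = ω(X,·)`). Then for every
`(X, α) ∈ V × V*` one has `(X,α)·e^{-ω̂} = (α - i_X ω̂) ∧ e^{-ω̂}`. -/
theorem stmt_5 (V : Type*) [AddCommGroup V] [Module ℝ V] [FiniteDimensional ℝ V]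
    (ω : V →ₗ[ℝ] Module.Dual ℝ V) (hω : ∀ X, ω X X = 0)
    (ωhat : ExteriorAlgebra ℝ (Module.Dual ℝ V))
    (hgrade : ωhat ∈ (LinearMap.range (ExteriorAlgebra.ι ℝ (M := Module.Dual ℝ V))) ^ 2)
    (hchar : ∀ X : V,
      CliffordAlgebra.contractLeft (Module.Dual.eval ℝ V X) ωhat = ExteriorAlgebra.ι ℝ (ω X)) :
    ∀ (X : V) (α : Module.Dual ℝ V),
      CliffordAlgebra.contractLeft (Module.Dual.eval ℝ V X) (expNegTwoForm V ωhat) +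
          ExteriorAlgebra.ι ℝ α * expNegTwoForm V ωhat =
        (ExteriorAlgebra.ι ℝ α - CliffordAlgebra.contractLeft (Module.Dual.eval ℝ V X) ωhat) *
          expNegTwoForm V ωhat := by
  intro X α
  have hfin : Module.finrank ℝ (Module.Dual ℝ V) < 2 * (Module.finrank ℝ V / 2 + 1) := by
    rw [Subspace.dual_finrank_eq]
    lia
  have htop : ExteriorAlgebra.ι ℝ (ω X) * ωhat ^ (Module.finrank ℝ V / 2) = 0 := by
    have h := contractLeft_pow_succ _ hgrade (hchar X) (Module.finrank ℝ V / 2)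
    rw [pow_eq_zero_of_mem_range_ι_sq hgrade hfin, map_zero] at h
    exact (smul_eq_zero.mp h.symm).resolve_left (by positivity)
  rw [sub_mul, hchar X, expNegTwoForm, contractLeft_sum_range_pow _ hgrade (hchar X),
    Finset.sum_range_succ, mul_add (ExteriorAlgebra.ι ℝ (ω X)),
    mul_smul_comm _ (ExteriorAlgebra.ι ℝ (ω X)), htop, smul_zero, add_zero, neg_add_eq_sub]
end

section
/- Every alternating linear map ω : V → V* on a finite-dimensional real vector space V admits an alternating partial inverse: there exists a linear map Π : V* → V with α(Πα) = 0 for all α ∈ V*, ω∘Π∘ω = ω, and Π∘ω∘Π = Π. -/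
/-- Every linear map between vector spaces has a (one-sided) generalized inverse. -/
theorem LinearMap.exists_comp_comp_eq_self {K V W : Type*} [Field K] [AddCommGroup V] [Module K V]
    [AddCommGroup W] [Module K W] (f : V →ₗ[K] W) :
    ∃ g : W →ₗ[K] V, ∀ x, f (g (f x)) = f x := by
  obtain ⟨s, hs⟩ := f.rangeRestrict.exists_rightInverse_of_surjective f.range_rangeRestrict
  obtain ⟨g, hg⟩ := s.exists_extend
  refine ⟨g, fun x => ?_⟩
  have h₁ : g (f x) = s (f.rangeRestrict x) := LinearMap.congr_fun hg (f.rangeRestrict x)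
  rw [h₁]
  exact congrArg Subtype.val (LinearMap.congr_fun hs (f.rangeRestrict x))

/-- Every alternating linear map `ω : V → V*` on a
finite-dimensional real vector space admits an alternating partial inverse. -/
theorem stmt_8 (V : Type*) [AddCommGroup V] [Module ℝ V] [FiniteDimensional ℝ V]
    (ω : V →ₗ[ℝ] Module.Dual ℝ V) (hω : ∀ X, ω X X = 0) :
    ∃ P : Module.Dual ℝ V →ₗ[ℝ] V,
      (∀ α : Module.Dual ℝ V, α (P α) = 0) ∧ ω ∘ₗ P ∘ₗ ω = ω ∧ P ∘ₗ ω ∘ₗ P = P := by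
  have skew : ∀ x y, ω x y = -ω y x := fun x y => (LinearMap.IsAlt.neg hω y x).symm
  obtain ⟨Q, hQ⟩ := ω.exists_comp_comp_eq_self
  -- the alternating generalized inverse is `-Qᵗ ∘ ω ∘ Q`
  let P : Module.Dual ℝ V →ₗ[ℝ] V :=
    -((Module.evalEquiv ℝ V).symm.toLinearMap ∘ₗ Q.dualMap ∘ₗ ω ∘ₗ Q)
  have hP : ∀ α β : Module.Dual ℝ V, β (P α) = ω (Q β) (Q α) := fun α β => by
    rw [skew]
    simp [P]
  have hωP : ∀ α, ω (P α) = ω (Q α) := fun α => by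
    ext x
    rw [skew, hP, hQ, ← skew]
  refine ⟨P, fun α => by rw [hP, hω], ?_, ?_⟩
  · ext x : 1
    simp [hωP, hQ]
  · ext α : 1
    refine (Module.forall_dual_apply_eq_zero_iff ℝ _).mp (fun β => ?_) |> sub_eq_zero.mp
    rw [map_sub, LinearMap.comp_apply, LinearMap.comp_apply, hωP, hP, hP, skew, hQ, ← skew,
      sub_self]
end

section
/- Let X be a connected topological space and let ω, Π : X → Mₙ(ℝ) be continuous maps into the n×n real matrices such that ω(x)Π(x)ω(x) = ω(x) and Π(x)ω(x)Π(x) = Π(x) for every x ∈ X. Then the function x ↦ rank(ω(x)) is constant on X. -/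
theorem Matrix.trace_eq_rank_of_isIdempotentElem {K m : Type*} [Field K] [Fintype m]
    [DecidableEq m] {A : Matrix m m K} (hA : IsIdempotentElem A) : A.trace = A.rank := by
  have hf : IsIdempotentElem (Matrix.toLin' A) := by
    rw [IsIdempotentElem, Module.End.mul_eq_comp, ← Matrix.toLin'_mul, hA.eq]
  rw [← Matrix.trace_toLin'_eq, (LinearMap.IsIdempotentElem.isProj_range _ hf).trace]
  rfl

theorem Matrix.rank_mul_eq_of_mul_mul_eq {R m n : Type*} [CommRing R] [StrongRankCondition R]
    [Fintype m] [Fintype n] {A : Matrix m n R} {B : Matrix n m R} (h : A * B * A = A) :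
    (A * B).rank = A.rank := by
  refine le_antisymm (Matrix.rank_mul_le_left A B) ?_
  simpa only [h] using Matrix.rank_mul_le_left (A * B) A

/-- If `ω, P : X → Mₙ(ℝ)` are continuous on a connected space `X`
and pointwise partial inverses (`ωPω = ω`, `PωP = P`), then `x ↦ rank (ω x)` is
constant. -/
theorem stmt_9 (n : ℕ) (X : Type*) [TopologicalSpace X] [ConnectedSpace X]
    (ω P : X → Matrix (Fin n) (Fin n) ℝ) (hω : Continuous ω) (hP : Continuous P)
    (h1 : ∀ x, ω x * P x * ω x = ω x) (h2 : ∀ x, P x * ω x * P x = P x) :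
    ∀ x y : X, (ω x).rank = (ω y).rank := by
  have htrace (x : X) : (ω x * P x).trace = (ω x).rank := by
    have hidem : IsIdempotentElem (ω x * P x) := by
      rw [IsIdempotentElem, ← mul_assoc, h1]
    rw [Matrix.trace_eq_rank_of_isIdempotentElem hidem, Matrix.rank_mul_eq_of_mul_mul_eq (h1 x)]
  have hcont : Continuous fun x => (ω x).rank := by
    rw [Nat.isClosedEmbedding_coe_real.isEmbedding.continuous_iff]
    exact (hω.mul hP).matrix_trace.congr htrace
  exact fun x y => PreconnectedSpace.constant inferInstance hcont
end

section
/- For m = (q,p) ∈ ℝ² × ℝ² with q ≠ 0, let ω_m be the alternating bilinear form on ℝ⁴ given in coordinates (q¹,q²,p₁,p₂) by ω = dq¹∧dp₁ + dq²∧dp₂ + ‖q‖^{−2} dq¹∧dq², i.e. ω_m(u,v) = (u₁v₃ − u₃v₁) + (u₂v₄ − u₄v₂) + ((q₁)² + (q₂)²)^{−1}(u₁v₂ − u₂v₁). Then there exist smooth maps s₁, s₂, s₃, s₄ : ℝ⁴ → ℝ⁴ × (ℝ⁴)* that are linearly independent at every point of ℝ⁴ and satisfy span{s₁(m), s₂(m),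 s₃(m), s₄(m)} = {(X, ω_m(X,·)) : X ∈ ℝ⁴} for every m = (q,p) with q ≠ 0. (Thus the graph of the magnetic symplectic form of a magnetic monopole in 2 dimensions extends to a smooth rank-4 subbundle of T(T*ℝ²) ⊕ T*(T*ℝ²) over all of T*ℝ² = ℝ⁴.) -/
/-- The magnetic symplectic form of a 2d magnetic monopole on `T*ℝ² = ℝ⁴` with
coordinates `(q¹,q²,p₁,p₂) = (x 0, x 1, x 2, x 3)`:
`ω = dq¹∧dp₁ + dq²∧dp₂ + ‖q‖⁻² dq¹∧dq²`. -/
noncomputable def monopole2dForm (x u v : Fin 4 → ℝ) : ℝ :=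
  (u 0 * v 2 - u 2 * v 0) + (u 1 * v 3 - u 3 * v 1) +
    (x 0 ^ 2 + x 1 ^ 2)⁻¹ * (u 0 * v 1 - u 1 * v 0)

/-- The smooth frame obtained from `∂/∂p₁, ∂/∂p₂, ‖q‖²∂/∂q¹ + ∂/∂p₂, ‖q‖²∂/∂q² - ∂/∂p₁`
by adjoining the covectors `ω(X,·)`. -/
def monopoleFrame : Fin 4 → (Fin 4 → ℝ) → (Fin 4 → ℝ) × (Fin 4 → ℝ) :=
  ![fun _ => (![0, 0, 1, 0], ![-1, 0, 0, 0]),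
    fun _ => (![0, 0, 0, 1], ![0, -1, 0, 0]),
    fun x => (![x 0 ^ 2 + x 1 ^ 2, 0, 0, 1], ![0, 0, x 0 ^ 2 + x 1 ^ 2, 0]),
    fun x => (![0, x 0 ^ 2 + x 1 ^ 2, -1, 0], ![0, 0, 0, x 0 ^ 2 + x 1 ^ 2])]

lemma contDiff_monopoleFrame (i : Fin 4) : ContDiff ℝ (⊤ : ℕ∞) (monopoleFrame i) := by
  fin_cases i <;> refine ContDiff.prodMk (contDiff_pi.2 fun j => ?_) (contDiff_pi.2 fun j => ?_) <;>
    fin_cases j <;> simp <;> fun_prop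

lemma sum_smul_monopoleFrame (c x : Fin 4 → ℝ) :
    ∑ i, c i • monopoleFrame i x =
      (![c 2 * (x 0 ^ 2 + x 1 ^ 2), c 3 * (x 0 ^ 2 + x 1 ^ 2), c 0 - c 3, c 1 + c 2],
        ![-c 0, -c 1, c 2 * (x 0 ^ 2 + x 1 ^ 2), c 3 * (x 0 ^ 2 + x 1 ^ 2)]) := by
  simp [Fin.sum_univ_four, monopoleFrame, sub_eq_add_neg]

lemma linearIndependent_monopoleFrame (x : Fin 4 → ℝ) :
    LinearIndependent ℝ (fun i => monopoleFrame i x) := by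
  refine Fintype.linearIndependent_iff.2 fun c hc i => ?_
  rw [sum_smul_monopoleFrame, Prod.ext_iff] at hc
  have h2 := congrFun hc.1 2
  have h3 := congrFun hc.1 3
  have k0 := congrFun hc.2 0
  have k1 := congrFun hc.2 1
  simp at h2 h3 k0 k1
  fin_cases i <;> simp <;> linarith

lemma monopole2dForm_single (x X : Fin 4 → ℝ) :
    (fun j => monopole2dForm x X (Pi.single j 1)) =
      ![-X 2 - (x 0 ^ 2 + x 1 ^ 2)⁻¹ * X 1, -X 3 + (x 0 ^ 2 + x 1 ^ 2)⁻¹ * X 0, X 0, X 1] := by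
  ext j
  fin_cases j <;> simp [monopole2dForm, sub_eq_add_neg]

/-- The graph of the magnetic symplectic form of a magnetic
monopole in 2 dimensions extends to a smooth rank-4 subbundle of
`T(T*ℝ²) ⊕ T*(T*ℝ²)` over all of `T*ℝ² = ℝ⁴`: there are smooth, everywhere
linearly independent sections `s₁,…,s₄ : ℝ⁴ → ℝ⁴ × (ℝ⁴)*` whose span at every point
`m = (q,p)` with `q ≠ 0` is the graph `{(X, ω_m(X,·))}`.  Here `(ℝ⁴)*` is
identified with `ℝ⁴` via the dual standard basis, so the covector `ω_m(X,·)` has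
coordinates `j ↦ ω_m(X, e_j)`. -/
theorem stmt_11 :
    ∃ s : Fin 4 → (Fin 4 → ℝ) → (Fin 4 → ℝ) × (Fin 4 → ℝ),
      (∀ i, ContDiff ℝ (⊤ : ℕ∞) (s i)) ∧
      (∀ x : Fin 4 → ℝ, LinearIndependent ℝ (fun i => s i x)) ∧
      ∀ x : Fin 4 → ℝ, (x 0 ≠ 0 ∨ x 1 ≠ 0) →
        (Submodule.span ℝ (Set.range fun i => s i x) : Set ((Fin 4 → ℝ) × (Fin 4 → ℝ))) =
          {p | ∃ X : Fin 4 → ℝ, p = (X, fun j => monopole2dForm x X (Pi.single j 1))} := by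
  refine ⟨monopoleFrame, contDiff_monopoleFrame, linearIndependent_monopoleFrame, ?_⟩
  intro x hx
  have hR : x 0 ^ 2 + x 1 ^ 2 ≠ 0 := by
    rcases hx with h | h <;> positivity
  ext p
  simp only [SetLike.mem_coe, Submodule.mem_span_range_iff_exists_fun, sum_smul_monopoleFrame,
    Set.mem_ofPred_eq, monopole2dForm_single]
  constructor
  · rintro ⟨c, rfl⟩
    refine ⟨_, Prod.ext rfl ?_⟩
    ext j
    fin_cases j <;> simp <;> field_simp <;> ring
  · rintro ⟨X, rfl⟩
    set r := (x 0 ^ 2 + x 1 ^ 2)⁻¹ with hr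
    refine ⟨![X 2 + r * X 1, X 3 - r * X 0, r * X 0, r * X 1], Prod.ext ?_ ?_⟩ <;>
      ext j <;> fin_cases j <;> simp [hr] <;> field_simp <;> ring
end

section
/- Let ω be a closed singular 2-form on U∖S with a singularity at m ∈ S. Then the singularity of ω at m is removable if and only if there exist an open neighborhood V ⊆ U of m, a smooth function f : V → ℝ, and a smooth map ψ : V → Λ(ℝⁿ)* with ψ(x) ≠ 0 for every x ∈ V, such that ψ(x) = f(x)·e^{−ω̂(x)} for all x ∈ V∖S. -/
noncomputable section

/-- The covector `ω(X,·) = (j ↦ Σᵢ Xᵢ ωᵢⱼ)` of the bilinear form with component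
matrix `A`, as a linear map `ℝⁿ → (ℝⁿ)* ≅ ℝⁿ`. -/
def covecMap {n : ℕ} (A : Fin n → Fin n → ℝ) : (Fin n → ℝ) →ₗ[ℝ] (Fin n → ℝ) :=
  (Matrix.of A).vecMulLinear

/-- The graph `{(X, ω(X,·)) : X ∈ ℝⁿ} ⊆ ℝⁿ × (ℝⁿ)*` of the bilinear form with
component matrix `A`, identifying `(ℝⁿ)*` with `ℝⁿ` via the dual standard basis. -/
def graphForm {n : ℕ} (A : Fin n → Fin n → ℝ) : Submodule ℝ ((Fin n → ℝ) × (Fin n → ℝ)) :=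
  LinearMap.graph (covecMap A)

/-- Partial derivative `∂ᵢ f (x)`. -/
def pd {n : ℕ} (f : (Fin n → ℝ) → ℝ) (i : Fin n) (x : Fin n → ℝ) : ℝ :=
  fderiv ℝ f x (Pi.single i 1)

/-- A singular 2-form on `U∖S`: smooth there, with alternating (skew) values. -/
def IsSingularTwoForm {n : ℕ} (U S : Set (Fin n → ℝ))
    (ω : (Fin n → ℝ) → Fin n → Fin n → ℝ) : Prop :=
  ContDiffOn ℝ (⊤ : ℕ∞) ω (U \ S) ∧ ∀ x ∈ U \ S, ∀ i j, ω x i j = - ω x j i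

/-- The 2-form `ω` is closed on the open set `O`:
`∂ᵢ ω_{jk} + ∂ⱼ ω_{ki} + ∂ₖ ω_{ij} = 0`. -/
def IsClosedTwoFormOn {n : ℕ} (ω : (Fin n → ℝ) → Fin n → Fin n → ℝ)
    (O : Set (Fin n → ℝ)) : Prop :=
  ∀ x ∈ O, ∀ i j k,
    pd (fun y => ω y j k) i x + pd (fun y => ω y k i) j x + pd (fun y => ω y i j) k x = 0

/-- `ω` has a singularity at `m ∈ S`: there is no smooth (skew-valued) extension of
`ω` to an open neighborhood of `m` inside `U`. -/
def HasSingularityAt {n : ℕ} (U S : Set (Fin n → ℝ))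
    (ω : (Fin n → ℝ) → Fin n → Fin n → ℝ) (m : Fin n → ℝ) : Prop :=
  ¬ ∃ (W : Set (Fin n → ℝ)) (ω' : (Fin n → ℝ) → Fin n → Fin n → ℝ),
      IsOpen W ∧ m ∈ W ∧ W ⊆ U ∧ ContDiffOn ℝ (⊤ : ℕ∞) ω' W ∧
      (∀ x ∈ W, ∀ i j, ω' x i j = - ω' x j i) ∧ ∀ x ∈ W \ S, ω' x = ω x

/-- The singularity of `ω` at `m` is removable in its graph: on some open
neighborhood `V ⊆ U` of `m` there are smooth, everywhere linearly independent
sections `s₁, …, sₙ : V → ℝⁿ × (ℝⁿ)*` spanning `Graph(ω(x))` at every `x ∈ V∖S`. -/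
def RemovableAt {n : ℕ} (U S : Set (Fin n → ℝ))
    (ω : (Fin n → ℝ) → Fin n → Fin n → ℝ) (m : Fin n → ℝ) : Prop :=
  ∃ (V : Set (Fin n → ℝ)) (s : Fin n → (Fin n → ℝ) → (Fin n → ℝ) × (Fin n → ℝ)),
    IsOpen V ∧ m ∈ V ∧ V ⊆ U ∧
    (∀ i, ContDiffOn ℝ (⊤ : ℕ∞) (s i) V) ∧
    (∀ x ∈ V, LinearIndependent ℝ (fun i => s i x)) ∧
    ∀ x ∈ V \ S, Submodule.span ℝ (Set.range fun i => s i x) = graphForm (ω x)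


/-- `ω̂ = Σ_{i<j} A_{ij} e^i ∧ e^j` in the exterior algebra of `ℝⁿ`
(our model for `Λ(ℝⁿ)*`, identifying `(ℝⁿ)*` with `ℝⁿ` via the standard basis). -/
def hatTwoForm {n : ℕ} (A : Fin n → Fin n → ℝ) : ExteriorAlgebra ℝ (Fin n → ℝ) :=
  ∑ i : Fin n, ∑ j : Fin n,
    if i < j then
      A i j • (ExteriorAlgebra.ι ℝ (Pi.single i 1) * ExteriorAlgebra.ι ℝ (Pi.single j 1))
    else 0

/-- `e^{-ω̂} = Σ_{k≥0} (-1)^k ω̂^{∧k}/k!` (a finite sum: all terms with `2k > n`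
vanish). -/
def expNegHat {n : ℕ} (A : Fin n → Fin n → ℝ) : ExteriorAlgebra ℝ (Fin n → ℝ) :=
  ∑ k ∈ Finset.range (n / 2 + 1), ((-1 : ℝ) ^ k / (Nat.factorial k : ℝ)) • hatTwoForm A ^ k

/-- The coefficient of `φ ∈ Λℝⁿ` on the wedge monomial `e^T = e_{t₁} ∧ ⋯ ∧ e_{tₖ}`
(`T = {t₁ < ⋯ < tₖ}`), extracted by successive contraction with the dual basis
functionals and taking the scalar part. -/
def monCoeff {n : ℕ} (T : Finset (Fin n)) (φ : ExteriorAlgebra ℝ (Fin n → ℝ)) : ℝ :=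
  ExteriorAlgebra.algebraMapInv
    ((T.sort (· ≤ ·)).foldl
      (fun ψ i =>
        CliffordAlgebra.contractLeft (M := Fin n → ℝ)
          (LinearMap.proj i : Module.Dual ℝ (Fin n → ℝ)) ψ)
      φ)


open CliffordAlgebra (contractLeft contractLeft_ι_mul contractLeft_comm contractLeft_contractLeft)

/-- The exterior algebra modelling `Λ(ℝⁿ)*`. -/
abbrev Forms (n : ℕ) := ExteriorAlgebra ℝ (Fin n → ℝ)

/-- Interior multiplication by a vector of `ℝⁿ`. -/
def interiorMul {n : ℕ} : (Fin n → ℝ) →ₗ[ℝ] Module.End ℝ (Forms n) :=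
  contractLeft ∘ₗ dotProductBilin ℝ ℝ

theorem interiorMul_ι_mul {n : ℕ} (X v : Fin n → ℝ) (φ : Forms n) :
    interiorMul X (ExteriorAlgebra.ι ℝ v * φ) =
      (X ⬝ᵥ v) • φ - ExteriorAlgebra.ι ℝ v * interiorMul X φ :=
  contractLeft_ι_mul _ v φ

theorem interiorMul_algebraMap {n : ℕ} (X : Fin n → ℝ) (r : ℝ) :
    interiorMul X (algebraMap ℝ (Forms n) r) = 0 :=
  CliffordAlgebra.contractLeft_algebraMap _ _ r

theorem interiorMul_one {n : ℕ} (X : Fin n → ℝ) : interiorMul X (1 : Forms n) = 0 :=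
  CliffordAlgebra.contractLeft_one _ _

theorem interiorMul_comm {n : ℕ} (X Y : Fin n → ℝ) (φ : Forms n) :
    interiorMul X (interiorMul Y φ) = -interiorMul Y (interiorMul X φ) :=
  contractLeft_comm _ _ φ

theorem interiorMul_self {n : ℕ} (X : Fin n → ℝ) (φ : Forms n) :
    interiorMul X (interiorMul X φ) = 0 :=
  contractLeft_contractLeft _ φ

theorem contractLeft_proj {n : ℕ} (i : Fin n) :
    contractLeft (M := Fin n → ℝ) (Q := (0 : QuadraticForm ℝ (Fin n → ℝ)))
      (LinearMap.proj i : Module.Dual ℝ (Fin n → ℝ)) = interiorMul (Pi.single i 1) := by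
  have : (LinearMap.proj i : Module.Dual ℝ (Fin n → ℝ)) =
      dotProductBilin ℝ ℝ (Pi.single i 1) := by
    ext j; simp [dotProductBilin]
  rw [this]; rfl

/-- Iterated interior multiplication by standard basis vectors; the head of the list acts first. -/
def contractList {n : ℕ} : List (Fin n) → Module.End ℝ (Forms n)
  | [] => LinearMap.id
  | i :: l => contractList l ∘ₗ interiorMul (Pi.single i 1)

theorem contractList_append {n : ℕ} (l l' : List (Fin n)) (φ : Forms n) :
    contractList (l ++ l') φ = contractList l' (contractList l φ) := by
  induction l generalizing φ with
  | nil => rfl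
  | cons i l ih => exact ih _

theorem contractList_eq_zero_of_perm {n : ℕ} {l l' : List (Fin n)} (h : l.Perm l')
    (φ : Forms n) (hφ : contractList l φ = 0) : contractList l' φ = 0 := by
  induction h generalizing φ with
  | nil => exact hφ
  | cons i _ ih => exact ih _ hφ
  | swap i j l =>
    have hφ' : contractList l
        (interiorMul (Pi.single i 1) (interiorMul (Pi.single j 1) φ)) = 0 := hφ
    rw [interiorMul_comm, map_neg, neg_eq_zero] at hφ'
    exact hφ'
  | trans _ _ ih₁ ih₂ => exact ih₂ _ (ih₁ _ hφ)

theorem monCoeff_eq {n : ℕ} (T : Finset (Fin n)) (φ : Forms n) :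
    monCoeff T φ = ExteriorAlgebra.algebraMapInv (contractList (T.sort (· ≤ ·)) φ) := by
  have (l : List (Fin n)) (φ : Forms n) : l.foldl
      (fun ψ i => contractLeft (M := Fin n → ℝ)
          (LinearMap.proj i : Module.Dual ℝ (Fin n → ℝ)) ψ) φ = contractList l φ := by
    induction l generalizing φ with
    | nil => rfl
    | cons i l ih =>
      rw [List.foldl_cons, ih, contractLeft_proj]; rfl
  rw [monCoeff, this]

theorem monCoeff_empty {n : ℕ} (φ : Forms n) :
    monCoeff ∅ φ = ExteriorAlgebra.algebraMapInv φ := by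
  rw [monCoeff_eq, Finset.sort_empty]; rfl

/-- The composite of the projections `φ ↦ ι_{eᵢ}(eⁱ ∧ φ)` over a list of indices. -/
def projList {n : ℕ} : List (Fin n) → Module.End ℝ (Forms n)
  | [] => LinearMap.id
  | i :: l => interiorMul (Pi.single i 1) ∘ₗ
      LinearMap.mulLeft ℝ (ExteriorAlgebra.ι ℝ (Pi.single i 1)) ∘ₗ projList l

theorem projList_cons {n : ℕ} (i : Fin n) (l : List (Fin n)) (φ : Forms n) :
    projList (i :: l) φ = interiorMul (Pi.single i 1)
      (ExteriorAlgebra.ι ℝ (Pi.single i 1) * projList l φ) := rfl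

theorem ι_mul_ι_mul_comm {n : ℕ} (v w : Fin n → ℝ) (φ : Forms n) :
    ExteriorAlgebra.ι ℝ v * (ExteriorAlgebra.ι ℝ w * φ) =
      -(ExteriorAlgebra.ι ℝ w * (ExteriorAlgebra.ι ℝ v * φ)) := by
  rw [← mul_assoc, ← mul_assoc, ← neg_mul]
  congr 1
  exact eq_neg_of_add_eq_zero_left (ExteriorAlgebra.ι_add_mul_swap v w)

theorem projList_algebraMap {n : ℕ} (l : List (Fin n)) (r : ℝ) :
    projList l (algebraMap ℝ (Forms n) r) = algebraMap ℝ (Forms n) r := by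
  induction l with
  | nil => rfl
  | cons i l ih => simp [projList_cons, ih, interiorMul_ι_mul, interiorMul_algebraMap]

theorem projList_ι_mul {n : ℕ} (l : List (Fin n)) (j : Fin n) (φ : Forms n) :
    projList l (ExteriorAlgebra.ι ℝ (Pi.single j 1) * φ) =
      if j ∈ l then 0 else ExteriorAlgebra.ι ℝ (Pi.single j 1) * projList l φ := by
  induction l with
  | nil => rfl
  | cons i l ih =>
    rw [projList_cons, ih]
    by_cases hl : j ∈ l
    · simp [hl]
    by_cases hij : j = i
    · subst hij
      simp [hl, ← mul_assoc]
    · rw [if_neg hl, if_neg (by simp [hl, hij]), ι_mul_ι_mul_comm, map_neg, interiorMul_ι_mul,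
        projList_cons]
      simp [Ne.symm hij]

theorem projList_mem_range {n : ℕ} {l : List (Fin n)} (hl : ∀ i, i ∈ l) (φ : Forms n) :
    projList l φ ∈ (⊥ : Subalgebra ℝ (Forms n)) := by
  induction φ using CliffordAlgebra.left_induction with
  | algebraMap r =>
    exact Algebra.mem_bot.2 ⟨r, (projList_algebraMap l r).symm⟩
  | add x y hx hy => rw [map_add]; exact add_mem hx hy
  | ι_mul x v hx =>
    have hv : v = ∑ j, v j • (Pi.single j 1 : Fin n → ℝ) := by
      ext k; simp [Finset.sum_apply, Pi.single_apply]
    change projList l (ExteriorAlgebra.ι ℝ v * x) ∈ _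
    rw [hv, map_sum, Finset.sum_mul, map_sum]
    refine sum_mem fun j _ => ?_
    rw [map_smul, smul_mul_assoc, map_smul, projList_ι_mul, if_pos (hl j), smul_zero]
    exact zero_mem _

theorem eq_algebraMap_of_interiorMul_eq_zero {n : ℕ} {φ : Forms n}
    (h : ∀ i, interiorMul (Pi.single i 1) φ = 0) :
    φ = algebraMap ℝ _ (ExteriorAlgebra.algebraMapInv φ) := by
  have (l : List (Fin n)) : projList l φ = φ := by
    induction l with
    | nil => rfl
    | cons i l ih => simp [projList_cons, ih, interiorMul_ι_mul, h]
  have hmem := projList_mem_range (l := Finset.univ.toList) (fun i => by simp) φ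
  rw [this] at hmem
  obtain ⟨r, hr⟩ := Algebra.mem_bot.1 hmem
  rw [← hr, ExteriorAlgebra.algebraMap_leftInverse]

open scoped Classical in
theorem exists_monCoeff_ne_zero {n : ℕ} {φ : Forms n} (hφ : φ ≠ 0) :
    ∃ T : Finset (Fin n), monCoeff T φ ≠ 0 := by
  obtain ⟨T, hT, hmax⟩ := Finset.exists_max_image
    (Finset.univ.filter fun T : Finset (Fin n) => contractList (T.sort (· ≤ ·)) φ ≠ 0)
    Finset.card ⟨∅, by simpa [contractList] using hφ⟩
  simp only [Finset.mem_filter, Finset.mem_univ, true_and] at hT hmax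
  refine ⟨T, fun h0 => hT ?_⟩
  rw [monCoeff_eq] at h0
  rw [eq_algebraMap_of_interiorMul_eq_zero (φ := contractList _ φ), h0, map_zero]
  intro i
  have hlist : interiorMul (Pi.single i 1) (contractList (T.sort (· ≤ ·)) φ) =
      contractList (T.sort (· ≤ ·) ++ [i]) φ := (contractList_append _ [i] φ).symm
  rw [hlist]
  by_cases hi : i ∈ T
  · have hp : (i :: i :: (T.sort (· ≤ ·)).erase i).Perm (T.sort (· ≤ ·) ++ [i]) :=
      ((List.perm_cons_erase ((Finset.mem_sort _).2 hi)).symm.cons i).trans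
        (List.perm_append_singleton i _).symm
    refine contractList_eq_zero_of_perm hp φ ?_
    change contractList _ (interiorMul _ (interiorMul _ φ)) = 0
    rw [interiorMul_self, map_zero]
  · have hp : ((insert i T).sort (· ≤ ·)).Perm (T.sort (· ≤ ·) ++ [i]) := by
      refine List.Perm.trans ?_ (List.perm_append_singleton i _).symm
      rw [← Multiset.coe_eq_coe, ← Multiset.cons_coe, Finset.sort_eq, Finset.sort_eq,
        Finset.insert_val_of_notMem hi]
    refine contractList_eq_zero_of_perm hp φ ?_
    by_contra hne
    have := hmax _ hne
    rw [Finset.card_insert_of_notMem hi] at this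
    omega

/-- `monCoeff T` as a linear functional. -/
def monCoeffLin {n : ℕ} (T : Finset (Fin n)) : Module.Dual ℝ (Forms n) :=
  ExteriorAlgebra.algebraMapInv.toLinearMap ∘ₗ contractList (T.sort (· ≤ ·))

theorem monCoeffLin_apply {n : ℕ} (T : Finset (Fin n)) (φ : Forms n) :
    monCoeffLin T φ = monCoeff T φ := (monCoeff_eq T φ).symm

theorem exists_dual_eq_sum_monCoeff {n : ℕ} (ℓ : Module.Dual ℝ (Forms n)) :
    ∃ c : Finset (Fin n) → ℝ, ∀ φ, ℓ φ = ∑ T, c T * monCoeff T φ := by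
  let M : Forms n →ₗ[ℝ] (Finset (Fin n) → ℝ) := LinearMap.pi monCoeffLin
  have hM : LinearMap.ker M = ⊥ := by
    refine LinearMap.ker_eq_bot'.2 fun φ h => ?_
    by_contra hφ
    obtain ⟨T, hT⟩ := exists_monCoeff_ne_zero hφ
    exact hT ((monCoeffLin_apply T φ).symm.trans (congrFun h T))
  obtain ⟨g, hg⟩ := M.exists_leftInverse_of_injective hM
  refine ⟨fun T => ℓ (g (Pi.single T 1)), fun φ => ?_⟩
  have hφ : φ = g (M φ) := (LinearMap.congr_fun hg φ).symm
  conv_lhs => rw [hφ, pi_eq_sum_univ' (M φ)]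
  simp only [map_sum, map_smul, smul_eq_mul]
  refine Finset.sum_congr rfl fun T _ => ?_
  rw [mul_comm, ← monCoeffLin_apply]
  rfl

/-- The standard Clifford action of `ℝⁿ × (ℝⁿ)*` on forms: `(X, ξ) · φ = ι_X φ + ξ ∧ φ`. -/
def cliffordAct {n : ℕ} : ((Fin n → ℝ) × (Fin n → ℝ)) →ₗ[ℝ] Module.End ℝ (Forms n) :=
  interiorMul ∘ₗ LinearMap.fst ℝ _ _ +
    LinearMap.mul ℝ (Forms n) ∘ₗ ExteriorAlgebra.ι ℝ ∘ₗ LinearMap.snd ℝ _ _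

theorem cliffordAct_apply {n : ℕ} (v : (Fin n → ℝ) × (Fin n → ℝ)) (φ : Forms n) :
    cliffordAct v φ = interiorMul v.1 φ + ExteriorAlgebra.ι ℝ v.2 * φ := rfl

/-- The neutral pairing `⟨(X, ξ), (Y, η)⟩ = ξ(Y) + η(X)` on `ℝⁿ × (ℝⁿ)*`. -/
def pairing {n : ℕ} (v w : (Fin n → ℝ) × (Fin n → ℝ)) : ℝ := v.1 ⬝ᵥ w.2 + w.1 ⬝ᵥ v.2

theorem cliffordAct_anticomm {n : ℕ} (v w : (Fin n → ℝ) × (Fin n → ℝ)) (φ : Forms n) :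
    cliffordAct v (cliffordAct w φ) + cliffordAct w (cliffordAct v φ) = pairing v w • φ := by
  simp only [cliffordAct_apply, map_add, interiorMul_ι_mul, pairing, add_smul]
  rw [interiorMul_comm v.1 w.1, ι_mul_ι_mul_comm v.2 w.2]
  abel

theorem cliffordAct_comm_of_pairing_eq_zero {n : ℕ} {v w : (Fin n → ℝ) × (Fin n → ℝ)}
    (h : pairing v w = 0) (φ : Forms n) :
    cliffordAct v (cliffordAct w φ) = -cliffordAct w (cliffordAct v φ) := by
  have := cliffordAct_anticomm v w φ
  rw [h, zero_smul] at this
  exact eq_neg_of_add_eq_zero_left this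

/-- The composite of the Clifford actions of the vectors of a list. -/
def cliffordProd {n : ℕ} : List ((Fin n → ℝ) × (Fin n → ℝ)) → Module.End ℝ (Forms n)
  | [] => LinearMap.id
  | v :: l => cliffordAct v ∘ₗ cliffordProd l

theorem cliffordProd_cons {n : ℕ} (v : (Fin n → ℝ) × (Fin n → ℝ))
    (l : List ((Fin n → ℝ) × (Fin n → ℝ))) (φ : Forms n) :
    cliffordProd (v :: l) φ = cliffordAct v (cliffordProd l φ) := rfl

theorem cliffordAct_cliffordProd_of_mem {n : ℕ} {l : List ((Fin n → ℝ) × (Fin n → ℝ))}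
    {v : (Fin n → ℝ) × (Fin n → ℝ)} (hv : v ∈ l) (h : ∀ w ∈ l, pairing v w = 0) (φ : Forms n) :
    cliffordAct v (cliffordProd l φ) = 0 := by
  induction l with
  | nil => simp at hv
  | cons a l ih =>
    rw [cliffordProd_cons]
    rcases List.mem_cons.1 hv with rfl | hv
    · have := cliffordAct_comm_of_pairing_eq_zero (h v (by simp)) (cliffordProd l φ)
      have h2 := add_eq_zero_iff_eq_neg.2 this
      rw [← two_smul ℝ] at h2
      exact (smul_eq_zero.1 h2).resolve_left two_ne_zero
    · rw [cliffordAct_comm_of_pairing_eq_zero (h a (by simp)),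
        ih hv fun w hw => h w (by simp [hw]), map_zero, neg_zero]

theorem cliffordProd_cliffordAct {n : ℕ} {l : List ((Fin n → ℝ) × (Fin n → ℝ))}
    {t : (Fin n → ℝ) × (Fin n → ℝ)} (h : ∀ w ∈ l, pairing w t = 0) (φ : Forms n) :
    cliffordProd l (cliffordAct t φ) =
      (-1 : ℝ) ^ l.length • cliffordAct t (cliffordProd l φ) := by
  induction l with
  | nil => simp [cliffordProd]
  | cons a l ih =>
    rw [cliffordProd_cons, ih fun w hw => h w (by simp [hw]), map_smul, cliffordProd_cons,
      cliffordAct_comm_of_pairing_eq_zero (h a (by simp)), List.length_cons, pow_succ]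
    simp

/-- Vectors admitting a dual family with respect to the pairing act by a nonzero product. -/
theorem exists_cliffordProd_ne_zero {n : ℕ} {ι : Type*} {s t : ι → (Fin n → ℝ) × (Fin n → ℝ)}
    (hd : ∀ i, pairing (s i) (t i) = 1) (ho : ∀ i j, i ≠ j → pairing (s i) (t j) = 0)
    {l : List ι} (hl : l.Nodup) : ∃ φ, cliffordProd (l.map s) φ ≠ 0 := by
  induction l with
  | nil => exact ⟨1, one_ne_zero⟩
  | cons a l ih =>
    obtain ⟨hal, hl⟩ := List.nodup_cons.1 hl
    obtain ⟨φ, hφ⟩ := ih hl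
    by_contra! hzero
    simp only [List.map_cons, cliffordProd_cons] at hzero
    have hcomm := hzero (cliffordAct (t a) φ)
    rw [cliffordProd_cliffordAct, map_smul] at hcomm
    · have h := cliffordAct_anticomm (s a) (t a) (cliffordProd (l.map s) φ)
      rw [hd, one_smul, hzero, map_zero, add_zero,
        (smul_eq_zero.1 hcomm).resolve_left (pow_ne_zero _ (by norm_num))] at h
      exact hφ h.symm
    · intro w hw
      obtain ⟨j, hj, rfl⟩ := List.mem_map.1 hw
      exact ho j a fun h => hal (h ▸ hj)

theorem prod_eq_sum_single {n : ℕ} (v : (Fin n → ℝ) × (Fin n → ℝ)) :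
    v = ∑ i, v.1 i • ((Pi.single i 1, 0) : (Fin n → ℝ) × (Fin n → ℝ)) +
      ∑ i, v.2 i • ((0, Pi.single i 1) : (Fin n → ℝ) × (Fin n → ℝ)) := by
  ext k <;> simp [Finset.sum_apply, Pi.single_apply, Prod.fst_sum, Prod.snd_sum]

theorem exists_pairing_eq {n : ℕ} (lam : Module.Dual ℝ ((Fin n → ℝ) × (Fin n → ℝ))) :
    ∃ t, ∀ v, pairing v t = lam v := by
  refine ⟨(fun i => lam (0, Pi.single i 1), fun i => lam (Pi.single i 1, 0)), fun v => ?_⟩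
  conv_rhs => rw [prod_eq_sum_single v]
  simp only [map_add, map_sum, map_smul, smul_eq_mul, pairing, dotProduct]
  congr 1
  exact Finset.sum_congr rfl fun i _ => mul_comm _ _

theorem exists_dual_family {n : ℕ} {ι : Type*} {s : ι → (Fin n → ℝ) × (Fin n → ℝ)}
    (hs : LinearIndependent ℝ s) : ∃ t : ι → (Fin n → ℝ) × (Fin n → ℝ),
      (∀ i, pairing (s i) (t i) = 1) ∧ ∀ i j, i ≠ j → pairing (s i) (t j) = 0 := by
  classical
  obtain ⟨g, hg⟩ := LinearMap.exists_extend hs.repr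
  choose t ht using fun j => exists_pairing_eq (Finsupp.lapply j ∘ₗ g)
  have hgs (i : ι) : g (s i) = Finsupp.single i 1 := by
    have hmem : s i ∈ Submodule.span ℝ (Set.range s) := Submodule.subset_span ⟨i, rfl⟩
    rw [← hs.repr_eq_single i ⟨s i, hmem⟩ rfl, ← hg]
    rfl
  refine ⟨t, fun i => ?_, fun i j hij => ?_⟩
  · simp [ht, hgs]
  · simp [ht, hgs, hij]

theorem finrank_le_of_isotropic {n : ℕ} {W : Submodule ℝ ((Fin n → ℝ) × (Fin n → ℝ))}
    (hW : ∀ v ∈ W, ∀ w ∈ W, pairing v w = 0) : Module.finrank ℝ W ≤ n := by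
  let σ := LinearEquiv.prodComm ℝ (Fin n → ℝ) (Fin n → ℝ)
  have hdisj : Disjoint W (W.map (σ : _ →ₗ[ℝ] _)) := by
    refine Submodule.disjoint_def.2 fun v hv hv' => ?_
    obtain ⟨w, hw, rfl⟩ := hv'
    have h := hW _ hv w hw
    change w.2 ⬝ᵥ w.2 + w.1 ⬝ᵥ w.1 = 0 at h
    have h1 : 0 ≤ w.1 ⬝ᵥ w.1 := Finset.sum_nonneg fun i _ => mul_self_nonneg _
    have h2 : 0 ≤ w.2 ⬝ᵥ w.2 := Finset.sum_nonneg fun i _ => mul_self_nonneg _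
    have h1' : w.1 = 0 := dotProduct_self_eq_zero.1 (by linarith)
    have h2' : w.2 = 0 := dotProduct_self_eq_zero.1 (by linarith)
    exact Prod.ext h2' h1'
  have h := Submodule.finrank_add_finrank_le_of_disjoint hdisj
  rw [LinearEquiv.finrank_map_eq] at h
  simp at h
  omega

/-- The annihilator of a form under the Clifford action. -/
def spinorAnn {n : ℕ} (φ : Forms n) : Submodule ℝ ((Fin n → ℝ) × (Fin n → ℝ)) :=
  LinearMap.ker (cliffordAct.flip φ)

theorem mem_spinorAnn {n : ℕ} {φ : Forms n} {v : (Fin n → ℝ) × (Fin n → ℝ)} :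
    v ∈ spinorAnn φ ↔ cliffordAct v φ = 0 := Iff.rfl

theorem finrank_spinorAnn_le {n : ℕ} {φ : Forms n} (hφ : φ ≠ 0) :
    Module.finrank ℝ (spinorAnn φ) ≤ n := by
  refine finrank_le_of_isotropic fun v hv w hw => ?_
  have h := cliffordAct_anticomm v w φ
  rw [mem_spinorAnn.1 hv, mem_spinorAnn.1 hw, map_zero, map_zero, add_zero] at h
  exact (smul_eq_zero.1 h.symm).resolve_right hφ

theorem covecMap_eq_sum {n : ℕ} {A : Fin n → Fin n → ℝ} (hA : ∀ i j, A i j = -A j i)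
    (X : Fin n → ℝ) :
    covecMap A X = ∑ i, ∑ j, if i < j then
      A i j • (X i • (Pi.single j 1 : Fin n → ℝ) - X j • Pi.single i 1) else 0 := by
  ext k
  have hsplit (i j : Fin n) : (if i < j then
      A i j • (X i • (Pi.single j 1 : Fin n → ℝ) - X j • Pi.single i 1) else 0 : Fin n → ℝ) k =
      (if k = j then (if i < j then A i j * X i else 0) else 0) -
      (if k = i then (if i < j then A i j * X j else 0) else 0) := by
    by_cases h : i < j <;> simp [h, Pi.single_apply, mul_sub]
  simp only [Finset.sum_apply, hsplit, Finset.sum_sub_distrib]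
  rw [Finset.sum_comm (f := fun i j => if k = i then (if i < j then A i j * X j else 0) else 0)]
  simp only [Finset.sum_ite_eq, Finset.mem_univ, if_true]
  rw [← Finset.sum_sub_distrib]
  change ∑ i, X i * A i k = _
  refine Finset.sum_congr rfl fun i _ => ?_
  rcases lt_trichotomy i k with h | h | h
  · simp [h, h.not_gt, mul_comm]
  · subst h
    have := hA i i
    simp [show A i i = 0 by linarith]
  · rw [hA i k]
    simp [h, h.not_gt, mul_comm]

theorem interiorMul_hatTwoForm_mul {n : ℕ} {A : Fin n → Fin n → ℝ}
    (hA : ∀ i j, A i j = -A j i) (X : Fin n → ℝ) (φ : Forms n) :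
    interiorMul X (hatTwoForm A * φ) =
      ExteriorAlgebra.ι ℝ (covecMap A X) * φ + hatTwoForm A * interiorMul X φ := by
  rw [covecMap_eq_sum hA, hatTwoForm]
  simp only [map_sum, Finset.sum_mul, ← Finset.sum_add_distrib]
  refine Finset.sum_congr rfl fun i _ => Finset.sum_congr rfl fun j _ => ?_
  split_ifs with h
  · simp only [smul_mul_assoc, map_smul, mul_assoc, interiorMul_ι_mul, map_sub, mul_sub, sub_mul,
      dotProduct_single, mul_one, mul_smul_comm]
    rw [← smul_add]
    congr 1
    abel
  · simp

theorem commute_hatTwoForm_ι {n : ℕ} (A : Fin n → Fin n → ℝ) (v : Fin n → ℝ) :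
    Commute (hatTwoForm A) (ExteriorAlgebra.ι ℝ v) := by
  refine Commute.sum_left _ _ _ fun i _ => Commute.sum_left _ _ _ fun j _ => ?_
  split_ifs
  · refine Commute.smul_left ?_ _
    have h (a b : Fin n → ℝ) : ExteriorAlgebra.ι ℝ a * ExteriorAlgebra.ι ℝ b =
        -(ExteriorAlgebra.ι ℝ b * ExteriorAlgebra.ι ℝ a) :=
      eq_neg_of_add_eq_zero_left (ExteriorAlgebra.ι_add_mul_swap a b)
    rw [commute_iff_eq, mul_assoc, h _ v, mul_neg, ← mul_assoc, h _ v, neg_mul, neg_neg, mul_assoc]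
  · exact Commute.zero_left _

theorem interiorMul_hatTwoForm_pow {n : ℕ} {A : Fin n → Fin n → ℝ}
    (hA : ∀ i j, A i j = -A j i) (X : Fin n → ℝ) (k : ℕ) :
    interiorMul X (hatTwoForm A ^ (k + 1)) =
      (k + 1 : ℝ) • (ExteriorAlgebra.ι ℝ (covecMap A X) * hatTwoForm A ^ k) := by
  induction k with
  | zero =>
    have := interiorMul_hatTwoForm_mul hA X 1
    simpa [interiorMul_one] using this
  | succ k ih =>
    rw [pow_succ', interiorMul_hatTwoForm_mul hA, ih, mul_smul_comm, ← mul_assoc,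
      (commute_hatTwoForm_ι A _).eq, mul_assoc, ← pow_succ', add_comm]
    push_cast
    rw [add_smul (k + 1 : ℝ), one_smul]

theorem hatTwoForm_pow_eq_zero {n : ℕ} (A : Fin n → Fin n → ℝ) :
    hatTwoForm A ^ (n / 2 + 1) = 0 := by
  have hmem : hatTwoForm A ∈ ⋀[ℝ]^2 (Fin n → ℝ) := by
    refine Submodule.sum_mem _ fun i _ => Submodule.sum_mem _ fun j _ => ?_
    split_ifs
    · refine Submodule.smul_mem _ _ ?_
      rw [ExteriorAlgebra.exteriorPower, pow_two]
      exact Submodule.mul_mem_mul ⟨_, rfl⟩ ⟨_, rfl⟩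
    · exact Submodule.zero_mem _
  have hpow := Submodule.pow_mem_pow _ hmem (n / 2 + 1)
  rw [ExteriorAlgebra.exteriorPower, ← pow_mul] at hpow
  have hbot : ⋀[ℝ]^(2 * (n / 2 + 1)) (Fin n → ℝ) = ⊥ := by
    rw [← Submodule.finrank_eq_zero (R := ℝ), exteriorPower.finrank_eq]
    simp only [Module.finrank_fin_fun]
    exact Nat.choose_eq_zero_of_lt (by omega)
  exact (Submodule.mem_bot ℝ).1 (hbot ▸ hpow)

theorem interiorMul_expNegHat {n : ℕ} {A : Fin n → Fin n → ℝ}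
    (hA : ∀ i j, A i j = -A j i) (X : Fin n → ℝ) :
    interiorMul X (expNegHat A) = -(ExteriorAlgebra.ι ℝ (covecMap A X) * expNegHat A) := by
  have htop : ExteriorAlgebra.ι ℝ (covecMap A X) * hatTwoForm A ^ (n / 2) = 0 := by
    have h := interiorMul_hatTwoForm_pow hA X (n / 2)
    rw [hatTwoForm_pow_eq_zero, map_zero] at h
    exact (smul_eq_zero.1 h.symm).resolve_left (by positivity)
  rw [expNegHat, map_sum, Finset.sum_range_succ', Finset.mul_sum, Finset.sum_range_succ]
  simp only [map_smul, mul_smul_comm, htop, smul_zero, add_zero, pow_zero, interiorMul_one,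
    interiorMul_hatTwoForm_pow hA, smul_smul, ← Finset.sum_neg_distrib, ← neg_smul]
  refine Finset.sum_congr rfl fun k _ => ?_
  congr 1
  rw [Nat.factorial_succ, pow_succ]
  push_cast
  field_simp

theorem algebraMapInv_ι_mul {n : ℕ} (v : Fin n → ℝ) (φ : Forms n) :
    ExteriorAlgebra.algebraMapInv (ExteriorAlgebra.ι ℝ v * φ) = 0 := by
  rw [map_mul]
  simp [ExteriorAlgebra.algebraMapInv]

theorem algebraMapInv_expNegHat {n : ℕ} (A : Fin n → Fin n → ℝ) :
    ExteriorAlgebra.algebraMapInv (expNegHat A) = 1 := by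
  have h0 : ExteriorAlgebra.algebraMapInv (hatTwoForm A) = 0 := by
    simp only [hatTwoForm, map_sum]
    refine Finset.sum_eq_zero fun i _ => Finset.sum_eq_zero fun j _ => ?_
    split_ifs
    · rw [map_smul, algebraMapInv_ι_mul, smul_zero]
    · exact map_zero _
  simp [expNegHat, Finset.sum_range_succ', h0]

theorem mem_graphForm {n : ℕ} {A : Fin n → Fin n → ℝ} {v : (Fin n → ℝ) × (Fin n → ℝ)} :
    v ∈ graphForm A ↔ v.2 = covecMap A v.1 := LinearMap.mem_graph_iff _ _

theorem pairing_eq_zero_of_mem_graphForm {n : ℕ} {A : Fin n → Fin n → ℝ}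
    (hA : ∀ i j, A i j = -A j i) {v w : (Fin n → ℝ) × (Fin n → ℝ)}
    (hv : v ∈ graphForm A) (hw : w ∈ graphForm A) : pairing v w = 0 := by
  rw [mem_graphForm] at hv hw
  rw [pairing, hv, hw]
  change v.1 ⬝ᵥ Matrix.vecMul w.1 (Matrix.of A) + w.1 ⬝ᵥ Matrix.vecMul v.1 (Matrix.of A) = 0
  have hT : (Matrix.of A).transpose = -Matrix.of A := by
    ext i j; exact hA j i
  rw [← Matrix.mulVec_transpose, hT, Matrix.neg_mulVec, dotProduct_neg,
    Matrix.dotProduct_mulVec, dotProduct_comm w.1, neg_add_cancel]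

/-- A form with zero scalar part vanishes if its interior products with the basis vectors lie in
the left ideal it generates. -/
theorem eq_zero_of_interiorMul_eq_mul {n : ℕ} {φ : Forms n}
    (hφ : ∀ i, ∃ β : Forms n, interiorMul (Pi.single i 1) φ = β * φ)
    (h0 : ExteriorAlgebra.algebraMapInv φ = 0) : φ = 0 := by
  have hideal (i : Fin n) (β : Forms n) : ∃ γ, interiorMul (Pi.single i 1) (β * φ) = γ * φ := by
    induction β using CliffordAlgebra.left_induction with
    | algebraMap r =>
      obtain ⟨γ, hγ⟩ := hφ i
      refine ⟨r • γ, ?_⟩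
      rw [← Algebra.smul_def, map_smul, hγ, smul_mul_assoc]
    | add x y hx hy =>
      obtain ⟨a, ha⟩ := hx
      obtain ⟨b, hb⟩ := hy
      exact ⟨a + b, by rw [add_mul, map_add, ha, hb, add_mul]⟩
    | ι_mul x v hx =>
      obtain ⟨a, ha⟩ := hx
      refine ⟨((Pi.single i 1 : Fin n → ℝ) ⬝ᵥ v) • x - ExteriorAlgebra.ι ℝ v * a, ?_⟩
      rw [mul_assoc, sub_mul, smul_mul_assoc, mul_assoc, ← ha]
      exact interiorMul_ι_mul _ _ _
  have hlist (l : List (Fin n)) (β : Forms n) : ∃ γ, contractList l (β * φ) = γ * φ := by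
    induction l generalizing β with
    | nil => exact ⟨β, rfl⟩
    | cons i l ih =>
      obtain ⟨γ, hγ⟩ := hideal i β
      obtain ⟨δ, hδ⟩ := ih γ
      exact ⟨δ, by rw [← hδ, ← hγ]; rfl⟩
  by_contra hne
  obtain ⟨T, hT⟩ := exists_monCoeff_ne_zero hne
  obtain ⟨γ, hγ⟩ := hlist (T.sort (· ≤ ·)) 1
  rw [one_mul] at hγ
  exact hT (by rw [monCoeff_eq, hγ, map_mul, h0, mul_zero])

theorem spinorAnn_expNegHat {n : ℕ} {A : Fin n → Fin n → ℝ} (hA : ∀ i j, A i j = -A j i) :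
    spinorAnn (expNegHat A) = graphForm A := by
  ext v
  rw [mem_spinorAnn, mem_graphForm, cliffordAct_apply, interiorMul_expNegHat hA]
  refine ⟨fun h => ?_, fun h => by rw [h, neg_add_cancel]⟩
  rw [neg_add_eq_zero] at h
  have hw : ExteriorAlgebra.ι ℝ (v.2 - covecMap A v.1) * expNegHat A = 0 := by
    rw [map_sub, sub_mul, h, sub_self]
  rw [← sub_eq_zero]
  ext i
  have hi := congrArg (interiorMul (Pi.single i 1)) hw
  rw [interiorMul_ι_mul, map_zero] at hi
  have := congrArg ExteriorAlgebra.algebraMapInv hi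
  rwa [map_sub ExteriorAlgebra.algebraMapInv, map_smul, algebraMapInv_ι_mul,
    algebraMapInv_expNegHat, sub_zero, map_zero, smul_eq_mul, mul_one, single_dotProduct,
    one_mul] at this

theorem eq_smul_expNegHat {n : ℕ} {A : Fin n → Fin n → ℝ} (hA : ∀ i j, A i j = -A j i)
    {φ : Forms n} (hφ : graphForm A ≤ spinorAnn φ) : φ = monCoeff ∅ φ • expNegHat A := by
  rw [monCoeff_empty, ← sub_eq_zero]
  refine eq_zero_of_interiorMul_eq_mul (fun i => ?_) ?_
  · refine ⟨-ExteriorAlgebra.ι ℝ (covecMap A (Pi.single i 1)), ?_⟩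
    have h : (Pi.single i 1, covecMap A (Pi.single i 1)) ∈ spinorAnn φ := hφ (mem_graphForm.2 rfl)
    rw [mem_spinorAnn, cliffordAct_apply] at h
    rw [map_sub, map_smul, interiorMul_expNegHat hA, eq_neg_of_add_eq_zero_left h, neg_mul,
      mul_sub, mul_smul_comm, smul_neg, neg_sub]
    abel
  · rw [map_sub, map_smul, algebraMapInv_expNegHat, smul_eq_mul, mul_one, sub_self]

/-- A linear map whose kernel has dimension at most `k` becomes, after composition with a suitable
linear map, surjective with kernel of dimension `k`. -/
theorem exists_comp_surjective {E F : Type*} [AddCommGroup E] [Module ℝ E] [FiniteDimensional ℝ E]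
    [AddCommGroup F] [Module ℝ F] (K : E →ₗ[ℝ] F) {k : ℕ}
    (hker : Module.finrank ℝ (LinearMap.ker K) ≤ k) :
    ∃ π : F →ₗ[ℝ] (Fin (Module.finrank ℝ E - k) → ℝ), Function.Surjective (π ∘ₗ K) := by
  have hrank := K.finrank_range_add_finrank_ker
  obtain ⟨b, hb⟩ := exists_linearIndependent_of_le_finrank
    (R := ℝ) (M := LinearMap.range K) (n := Module.finrank ℝ E - k) (by omega)
  choose c hc using fun i => (b i).2
  have hb' : LinearIndependent ℝ fun i => K (c i) := by
    simp only [hc]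
    exact hb.map' (LinearMap.range K).subtype (Submodule.ker_subtype _)
  let κ : (Fin (Module.finrank ℝ E - k) → ℝ) →ₗ[ℝ] E := Fintype.linearCombination ℝ c
  have hκ : LinearMap.ker (K ∘ₗ κ) = ⊥ := by
    have : K ∘ₗ κ = Fintype.linearCombination ℝ fun i => K (c i) := by
      ext; simp [κ]
    rw [this]
    exact LinearMap.ker_eq_bot.2 hb'.fintypeLinearCombination_injective
  obtain ⟨π, hπ⟩ := (K ∘ₗ κ).exists_leftInverse_of_injective hκ
  exact ⟨π, fun y => ⟨κ y, LinearMap.congr_fun hπ y⟩⟩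

/-- A smooth family of linear maps has, near a point where its kernel has dimension at most `k`,
a smooth linearly independent `k`-tuple spanning each kernel of dimension `k`. -/
theorem exists_smooth_kernel_frame {P E F : Type*} [NormedAddCommGroup P] [NormedSpace ℝ P]
    [NormedAddCommGroup E] [NormedSpace ℝ E] [FiniteDimensional ℝ E]
    [NormedAddCommGroup F] [NormedSpace ℝ F] [FiniteDimensional ℝ F]
    {K : P → E →L[ℝ] F} {V : Set P} (hV : IsOpen V) (hK : ContDiffOn ℝ (⊤ : ℕ∞) K V)
    {m : P} (hm : m ∈ V) {k : ℕ} (hkE : k ≤ Module.finrank ℝ E)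
    (hker : Module.finrank ℝ (LinearMap.ker (K m).toLinearMap) ≤ k) :
    ∃ (W : Set P) (s : Fin k → P → E), IsOpen W ∧ m ∈ W ∧ W ⊆ V ∧
      (∀ i, ContDiffOn ℝ (⊤ : ℕ∞) (s i) W) ∧ (∀ x ∈ W, LinearIndependent ℝ fun i => s i x) ∧
      ∀ x ∈ W, Module.finrank ℝ (LinearMap.ker (K x).toLinearMap) = k →
        Submodule.span ℝ (Set.range fun i => s i x) = LinearMap.ker (K x).toLinearMap := by
  obtain ⟨π, hπ⟩ := exists_comp_surjective (K m).toLinearMap hker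
  let J : Submodule ℝ E := LinearMap.ker (π ∘ₗ (K m).toLinearMap)
  have hJ : Module.finrank ℝ J = k := by
    have h := (π ∘ₗ (K m).toLinearMap).finrank_range_add_finrank_ker
    rw [LinearMap.range_eq_top.2 hπ, finrank_top, Module.finrank_fin_fun] at h
    change _ + Module.finrank ℝ J = _ at h
    omega
  obtain ⟨j, hj⟩ := J.subtype.exists_leftInverse_of_injective J.ker_subtype
  let Φ : P → E →L[ℝ] J × (Fin (Module.finrank ℝ E - k) → ℝ) := fun x =>
    (LinearMap.toContinuousLinearMap j).prod ((LinearMap.toContinuousLinearMap π).comp (K x))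
  have hΦ : ContDiffOn ℝ (⊤ : ℕ∞) Φ V := by
    refine contDiffOn_clm_apply.2 fun y => contDiffOn_const.prodMk ?_
    exact (LinearMap.toContinuousLinearMap π).contDiff.comp_contDiffOn
      (contDiffOn_clm_apply.1 hK y)
  have hinj : Function.Injective (Φ m).toLinearMap := by
    refine (injective_iff_map_eq_zero _).2 fun v hv => ?_
    obtain ⟨h₁, h₂⟩ := Prod.ext_iff.1 hv
    have hvJ : v ∈ J := h₂
    have := LinearMap.congr_fun hj ⟨v, hvJ⟩
    have h₁' : j v = 0 := h₁
    simp only [LinearMap.comp_apply, Submodule.subtype_apply, h₁', LinearMap.id_apply] at this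
    exact congrArg Subtype.val this.symm
  let e : E ≃L[ℝ] J × (Fin (Module.finrank ℝ E - k) → ℝ) :=
    (LinearMap.linearEquivOfInjective (Φ m).toLinearMap hinj (by
      rw [Module.finrank_prod, hJ, Module.finrank_fin_fun]; omega)).toContinuousLinearEquiv
  have he : (e : E →L[ℝ] _) = Φ m := by ext v <;> rfl
  let W : Set P := V ∩ Φ ⁻¹' Set.range
    ((↑) : (E ≃L[ℝ] J × (Fin (Module.finrank ℝ E - k) → ℝ)) → E →L[ℝ] _)
  have hW : IsOpen W := hΦ.continuousOn.isOpen_inter_preimage hV ContinuousLinearEquiv.isOpen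
  let b := Module.finBasisOfFinrankEq ℝ J hJ
  have hinv (x : P) (hx : x ∈ W) (y) : Φ x (ContinuousLinearMap.inverse (Φ x) y) = y := by
    obtain ⟨a, ha⟩ := hx.2
    rw [← ha, ContinuousLinearMap.inverse_equiv]
    exact a.apply_symm_apply y
  have hLI (x : P) (hx : x ∈ W) :
      LinearIndependent ℝ fun i => ContinuousLinearMap.inverse (Φ x) (b i, 0) := by
    refine LinearIndependent.of_comp (LinearMap.fst ℝ _ _ ∘ₗ (Φ x).toLinearMap) ?_
    convert b.linearIndependent using 1
    ext1 i
    exact congrArg Prod.fst (hinv x hx (b i, 0))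
  refine ⟨W, fun i x => ContinuousLinearMap.inverse (Φ x) (b i, 0), hW, ⟨hm, e, he⟩,
    Set.inter_subset_left, fun i x hx => ?_, hLI, fun x hx hdim => ?_⟩
  · obtain ⟨a, ha⟩ := hx.2
    have h₁ : ContDiffAt ℝ (⊤ : ℕ∞) Φ x := hΦ.contDiffAt (hV.mem_nhds hx.1)
    have h₂ : ContDiffAt ℝ (⊤ : ℕ∞) ContinuousLinearMap.inverse (Φ x) :=
      ha ▸ contDiffAt_map_inverse a
    exact ((h₂.comp x h₁).clm_apply contDiffAt_const).contDiffWithinAt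
  · refine (Submodule.eq_of_le_of_finrank_eq (fun v hv => ?_) ?_).symm
    · have hv' : Φ x v = (j v, 0) :=
        Prod.ext rfl (by change π (K x v) = 0; rw [show K x v = 0 from hv, map_zero])
      have hvs : v = ContinuousLinearMap.inverse (Φ x) (j v, 0) := by
        obtain ⟨a, ha⟩ := hx.2
        rw [← hv', ← ha, ContinuousLinearMap.inverse_equiv]
        exact (a.symm_apply_apply v).symm
      rw [hvs, ← b.sum_repr (j v)]
      have : ((∑ i, b.repr (j v) i • b i, 0) : J × (Fin (Module.finrank ℝ E - k) → ℝ)) =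
          ∑ i, b.repr (j v) i • (b i, 0) := by
        ext1
        · simp [Prod.fst_sum]
        · simp [Prod.snd_sum]
      rw [this, map_sum]
      refine Submodule.sum_mem _ fun i _ => ?_
      rw [map_smul]
      exact Submodule.smul_mem _ _ (Submodule.subset_span ⟨i, rfl⟩)
    · rw [hdim, finrank_span_eq_card (hLI x hx), Fintype.card_fin]

/-- Smoothness of a family of forms on a set, tested on linear functionals. -/
def SmoothFormOn {n : ℕ} (ψ : (Fin n → ℝ) → Forms n) (V : Set (Fin n → ℝ)) : Prop :=
  ∀ ℓ : Module.Dual ℝ (Forms n), ContDiffOn ℝ (⊤ : ℕ∞) (fun x => ℓ (ψ x)) V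

theorem SmoothFormOn.monCoeff {n : ℕ} {ψ : (Fin n → ℝ) → Forms n} {V : Set (Fin n → ℝ)}
    (h : SmoothFormOn ψ V) (T : Finset (Fin n)) :
    ContDiffOn ℝ (⊤ : ℕ∞) (fun x => monCoeff T (ψ x)) V := by
  simpa only [monCoeffLin_apply] using h (monCoeffLin T)

theorem smoothFormOn_of_monCoeff {n : ℕ} {ψ : (Fin n → ℝ) → Forms n} {V : Set (Fin n → ℝ)}
    (h : ∀ T : Finset (Fin n), ContDiffOn ℝ (⊤ : ℕ∞) (fun x => monCoeff T (ψ x)) V) :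
    SmoothFormOn ψ V := by
  intro ℓ
  obtain ⟨c, hc⟩ := exists_dual_eq_sum_monCoeff ℓ
  simp only [hc]
  exact ContDiffOn.sum fun T _ => contDiffOn_const.mul (h T)

theorem SmoothFormOn.cliffordAct {n : ℕ} {ψ : (Fin n → ℝ) → Forms n}
    {s : (Fin n → ℝ) → (Fin n → ℝ) × (Fin n → ℝ)} {V : Set (Fin n → ℝ)}
    (hψ : SmoothFormOn ψ V) (hs : ContDiffOn ℝ (⊤ : ℕ∞) s V) :
    SmoothFormOn (fun x => cliffordAct (s x) (ψ x)) V := by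
  intro ℓ
  have h (x : Fin n → ℝ) : ℓ (_root_.cliffordAct (s x) (ψ x)) =
      ∑ i, (s x).1 i * (ℓ ∘ₗ _root_.cliffordAct (Pi.single i 1, 0)) (ψ x) +
        ∑ i, (s x).2 i * (ℓ ∘ₗ _root_.cliffordAct (0, Pi.single i 1)) (ψ x) := by
    conv_lhs => rw [prod_eq_sum_single (s x)]
    simp only [map_add, map_sum, map_smul, LinearMap.add_apply, LinearMap.sum_apply,
      LinearMap.smul_apply, smul_eq_mul, LinearMap.comp_apply]
  simp only [h]
  exact (ContDiffOn.sum fun i _ => (contDiffOn_pi.1 hs.fst i).mul (hψ _)).add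
    (ContDiffOn.sum fun i _ => (contDiffOn_pi.1 hs.snd i).mul (hψ _))

theorem SmoothFormOn.cliffordProd {n : ℕ} {ι : Type*}
    {s : ι → (Fin n → ℝ) → (Fin n → ℝ) × (Fin n → ℝ)} {V : Set (Fin n → ℝ)}
    (hs : ∀ i, ContDiffOn ℝ (⊤ : ℕ∞) (s i) V) (l : List ι) (φ : Forms n) :
    SmoothFormOn (fun x => cliffordProd (l.map fun i => s i x) φ) V := by
  induction l with
  | nil => exact fun ℓ => contDiffOn_const (c := ℓ φ)
  | cons i l ih => exact ih.cliffordAct (hs i)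

theorem finrank_graphForm {n : ℕ} (A : Fin n → Fin n → ℝ) :
    Module.finrank ℝ (graphForm A) = n := by
  rw [graphForm, LinearMap.graph_eq_range_prod, LinearMap.finrank_range_of_inj,
    Module.finrank_fin_fun]
  exact fun _ _ h => congrArg Prod.fst h

/-- (Prop. `SpinorRemove`.)  A closed singular 2-form `ω` on
`U∖S` with a singularity at `m ∈ S` has a removable singularity at `m` iff near `m`
there are a smooth function `f` and a smooth nowhere-vanishing form
`ψ : V → Λ(ℝⁿ)*` with `ψ = f·e^{-ω̂}` off `S`.  (Smoothness of `ψ` is expressed by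
smoothness of all its wedge-monomial coefficients.) -/
theorem stmt_12 {n : ℕ} (hn : 2 ≤ n) (U S : Set (Fin n → ℝ))
    (hU : IsOpen U) (hSU : S ⊆ U) (hUS : IsOpen (U \ S)) (hdense : U ⊆ closure (U \ S))
    (ω : (Fin n → ℝ) → Fin n → Fin n → ℝ)
    (hω : IsSingularTwoForm U S ω) (hcl : IsClosedTwoFormOn ω (U \ S))
    (m : Fin n → ℝ) (hm : m ∈ S) (hsing : HasSingularityAt U S ω m) :
    RemovableAt U S ω m ↔
      ∃ (V : Set (Fin n → ℝ)) (f : (Fin n → ℝ) → ℝ)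
        (ψ : (Fin n → ℝ) → ExteriorAlgebra ℝ (Fin n → ℝ)),
        IsOpen V ∧ m ∈ V ∧ V ⊆ U ∧
        ContDiffOn ℝ (⊤ : ℕ∞) f V ∧
        (∀ T : Finset (Fin n), ContDiffOn ℝ (⊤ : ℕ∞) (fun x => monCoeff T (ψ x)) V) ∧
        (∀ x ∈ V, ψ x ≠ 0) ∧
        ∀ x ∈ V \ S, ψ x = f x • expNegHat (ω x) := by
  constructor
  · rintro ⟨V, s, hV, hmV, hVU, hs, hLI, hspan⟩
    obtain ⟨t, hd, ho⟩ := exists_dual_family (hLI m hmV)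
    obtain ⟨φ, hφ⟩ := exists_cliffordProd_ne_zero hd ho (List.nodup_finRange n)
    have hψ := SmoothFormOn.cliffordProd hs (List.finRange n) φ
    obtain ⟨T, hT⟩ := exists_monCoeff_ne_zero hφ
    refine ⟨_, _, _, (hψ.monCoeff T).continuousOn.isOpen_inter_preimage hV isOpen_compl_singleton,
      ⟨hmV, hT⟩, Set.inter_subset_left.trans hVU, (hψ.monCoeff ∅).mono Set.inter_subset_left,
      fun T => (hψ.monCoeff T).mono Set.inter_subset_left, fun x hx h0 => hx.2 ?_,
      fun x hx => eq_smul_expNegHat (hω.2 x ⟨hVU hx.1.1, hx.2⟩) ?_⟩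
    · change monCoeff T _ = 0
      rw [h0, ← monCoeffLin_apply, map_zero]
    · have hsx := hspan x ⟨hx.1.1, hx.2⟩
      have hmem (i : Fin n) : s i x ∈ graphForm (ω x) := by
        rw [← hsx]
        exact Submodule.subset_span ⟨i, rfl⟩
      rw [← hsx, Submodule.span_le]
      rintro _ ⟨i, rfl⟩
      have hi : s i x ∈ (List.finRange n).map fun i => s i x :=
        List.mem_map.2 ⟨i, List.mem_finRange i, rfl⟩
      refine mem_spinorAnn.2 (cliffordAct_cliffordProd_of_mem hi (fun w hw => ?_) φ)
      obtain ⟨j, -, rfl⟩ := List.mem_map.1 hw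
      exact pairing_eq_zero_of_mem_graphForm (hω.2 x ⟨hVU hx.1.1, hx.2⟩) (hmem i) (hmem j)
  · rintro ⟨V, f, ψ, hV, hmV, hVU, -, hψ, hne, heq⟩
    let K : (Fin n → ℝ) → ((Fin n → ℝ) × (Fin n → ℝ)) →L[ℝ] (Finset (Fin n) → ℝ) := fun x =>
      LinearMap.toContinuousLinearMap
        (LinearMap.pi fun T => monCoeffLin T ∘ₗ cliffordAct.flip (ψ x))
    have hK : ContDiffOn ℝ (⊤ : ℕ∞) K V := by
      refine contDiffOn_clm_apply.2 fun v => contDiffOn_pi.2 fun T => ?_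
      exact smoothFormOn_of_monCoeff hψ (monCoeffLin T ∘ₗ cliffordAct v)
    have hker (x : Fin n → ℝ) : LinearMap.ker (K x).toLinearMap = spinorAnn (ψ x) := by
      ext v
      refine ⟨fun hv => ?_, fun hv => funext fun T => ?_⟩
      · by_contra hne
        obtain ⟨T, hT⟩ := exists_monCoeff_ne_zero hne
        rw [← monCoeffLin_apply] at hT
        exact hT (congrFun hv T)
      · change monCoeffLin T (cliffordAct v (ψ x)) = 0
        rw [mem_spinorAnn.1 hv, map_zero]
    have hgraph (x : Fin n → ℝ) (hx : x ∈ V \ S) : spinorAnn (ψ x) = graphForm (ω x) := by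
      rw [← spinorAnn_expNegHat (hω.2 x ⟨hVU hx.1, hx.2⟩), heq x hx]
      have hf : f x ≠ 0 := fun h0 => hne x hx.1 (by rw [heq x hx, h0, zero_smul])
      ext v
      rw [mem_spinorAnn, mem_spinorAnn, map_smul, smul_eq_zero_iff_right hf]
    obtain ⟨W, s, hW, hmW, hWV, hs, hLI, hspan⟩ := exists_smooth_kernel_frame hV hK hmV
      (k := n) (by simp) ((hker m).symm ▸ finrank_spinorAnn_le (hne m hmV))
    refine ⟨W, s, hW, hmW, hWV.trans hVU, hs, hLI, fun x hx => ?_⟩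
    have hxg := (hker x).trans (hgraph x ⟨hWV hx.1, hx.2⟩)
    rw [hspan x hx.1 (hxg ▸ finrank_graphForm (ω x)), hxg]

end
end

section
/- Let ω be a closed singular 2-form on U∖S with a singularity at m ∈ S. If the singularity is bounded, i.e. there exist an open neighborhood V ⊆ U of m and a constant C ≥ 0 such that |ω_{ij}(x)| ≤ C for all x ∈ V∖S and all indices i,j, then the singularity of ω at m is not removable. -/
noncomputable section

section MatrixSmoothness

variable {𝕜 E ι : Type*} [NontriviallyNormedField 𝕜] [NormedAddCommGroup E] [NormedSpace 𝕜 E]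
  [Fintype ι] [DecidableEq ι] {k : WithTop ℕ∞} {A : E → Matrix ι ι 𝕜} {s : Set E}

theorem ContDiffOn.matrix_det (hA : ∀ i j, ContDiffOn 𝕜 k (fun x => A x i j) s) :
    ContDiffOn 𝕜 k (fun x => (A x).det) s := by
  simp only [Matrix.det_apply']
  exact ContDiffOn.sum fun σ _ => contDiffOn_const.mul (contDiffOn_prod fun i _ => hA (σ i) i)

theorem ContDiffOn.matrix_adjugate (hA : ∀ i j, ContDiffOn 𝕜 k (fun x => A x i j) s) (i j : ι) :
    ContDiffOn 𝕜 k (fun x => (A x).adjugate i j) s := by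
  simp only [Matrix.adjugate_apply]
  refine ContDiffOn.matrix_det fun p q => ?_
  by_cases hp : p = j
  · subst hp
    simpa only [Matrix.updateRow_self] using contDiffOn_const
  · simpa only [Matrix.updateRow_ne hp] using hA p q

theorem ContDiffOn.matrix_inv (hA : ∀ i j, ContDiffOn 𝕜 k (fun x => A x i j) s)
    (hdet : ∀ x ∈ s, (A x).det ≠ 0) (i j : ι) :
    ContDiffOn 𝕜 k (fun x => (A x)⁻¹ i j) s := by
  simp only [Matrix.inv_def, Ring.inverse_eq_inv', Matrix.smul_apply, smul_eq_mul]
  exact ((ContDiffOn.matrix_det hA).inv hdet).mul (ContDiffOn.matrix_adjugate hA i j)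

end MatrixSmoothness

/-- If `B = A * M` along a filter with `M` bounded, then in the limit every left null vector
of `A` is a left null vector of `B`. -/
theorem Matrix.vecMul_eq_zero_of_tendsto_of_bounded {X ι : Type*} [Fintype ι] {l : Filter X}
    [l.NeBot] {A B M : X → Matrix ι ι ℝ} {A₀ B₀ : Matrix ι ι ℝ} {C : ℝ}
    (hA : Filter.Tendsto A l (nhds A₀)) (hB : Filter.Tendsto B l (nhds B₀))
    (hM : ∀ᶠ x in l, ∀ i j, |M x i j| ≤ C) (hAB : ∀ᶠ x in l, B x = A x * M x)
    {v : ι → ℝ} (hv : Matrix.vecMul v A₀ = 0) : Matrix.vecMul v B₀ = 0 := by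
  have hcont : Continuous fun N : Matrix ι ι ℝ => Matrix.vecMul v N := by fun_prop
  have hvA : Filter.Tendsto (fun x => Matrix.vecMul v (A x)) l (nhds 0) :=
    hv ▸ (hcont.tendsto A₀).comp hA
  have hvB : Filter.Tendsto (fun x => Matrix.vecMul v (B x)) l (nhds (Matrix.vecMul v B₀)) :=
    (hcont.tendsto B₀).comp hB
  refine tendsto_nhds_unique hvB (tendsto_pi_nhds.2 fun j => ?_)
  have hsum : Filter.Tendsto (fun x => ∑ i, Matrix.vecMul v (A x) i * M x i j) l
      (nhds (∑ _i : ι, (0 : ℝ))) := by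
    refine tendsto_finsetSum _ fun i _ => ?_
    refine Filter.Tendsto.zero_mul_isBoundedUnder_le (tendsto_pi_nhds.1 hvA i) ⟨C, ?_⟩
    exact Filter.eventually_map.2 (hM.mono fun x hx => hx i j)
  rw [Finset.sum_const_zero] at hsum
  refine hsum.congr' (hAB.mono fun x hx => ?_)
  change Matrix.vecMul (Matrix.vecMul v (A x)) (M x) j = Matrix.vecMul v (B x) j
  rw [hx, Matrix.vecMul_vecMul]

/-- A bounded singularity of a closed singular 2-form is not
removable: if `ω` has a singularity at `m ∈ S` and all components `ω_{ij}` are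
bounded near `m`, then the singularity of `ω` at `m` is not removable. -/
theorem stmt_14 {n : ℕ} (hn : 2 ≤ n) (U S : Set (Fin n → ℝ))
    (hU : IsOpen U) (hSU : S ⊆ U) (hUS : IsOpen (U \ S)) (hdense : U ⊆ closure (U \ S))
    (ω : (Fin n → ℝ) → Fin n → Fin n → ℝ)
    (hω : IsSingularTwoForm U S ω) (hcl : IsClosedTwoFormOn ω (U \ S))
    (m : Fin n → ℝ) (hm : m ∈ S) (hsing : HasSingularityAt U S ω m)
    (hbdd : ∃ (V : Set (Fin n → ℝ)) (C : ℝ),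
      IsOpen V ∧ m ∈ V ∧ V ⊆ U ∧ 0 ≤ C ∧ ∀ x ∈ V \ S, ∀ i j, |ω x i j| ≤ C) :
    ¬ RemovableAt U S ω m := by
  rintro ⟨V, s, hV, hmV, hVU, hs, hli, hspan⟩
  obtain ⟨V', C, hV', hmV', -, -, hC⟩ := hbdd
  set a : (Fin n → ℝ) → Matrix (Fin n) (Fin n) ℝ := fun x => Matrix.of fun i => (s i x).1 with ha
  set b : (Fin n → ℝ) → Matrix (Fin n) (Fin n) ℝ := fun x => Matrix.of fun i => (s i x).2 with hb
  have hsa : ∀ i j, ContDiffOn ℝ (⊤ : ℕ∞) (fun x => a x i j) V := fun i j =>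
    contDiffOn_pi.1 (hs i).fst j
  have hsb : ∀ i j, ContDiffOn ℝ (⊤ : ℕ∞) (fun x => b x i j) V := fun i j =>
    contDiffOn_pi.1 (hs i).snd j
  have hgraph : ∀ x ∈ V \ S, b x = a x * Matrix.of (ω x) := by
    intro x hx
    ext i j
    have hmem : s i x ∈ graphForm (ω x) :=
      hspan x hx ▸ Submodule.subset_span (Set.mem_range_self i)
    exact congrFun ((LinearMap.mem_graph_iff _ _).1 hmem) j
  have hdense_open : ∀ W : Set (Fin n → ℝ), IsOpen W → W ⊆ U → ∀ x ∈ W,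
      (nhdsWithin x (W \ S)).NeBot := by
    intro W hW hWU x hx
    refine mem_closure_iff_nhdsWithin_neBot.1 ?_
    refine closure_mono ?_ (hW.inter_closure ⟨hx, hdense (hWU hx)⟩)
    exact fun y hy => ⟨hy.1, hy.2.2⟩
  have htendsto : ∀ {f : (Fin n → ℝ) → Matrix (Fin n) (Fin n) ℝ},
      (∀ i j, ContDiffOn ℝ (⊤ : ℕ∞) (fun x => f x i j) V) → Filter.Tendsto f (nhds m) (nhds (f m)) :=
    fun hf => tendsto_pi_nhds.2 fun i => tendsto_pi_nhds.2 fun j =>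
      (hf i j).continuousOn.continuousAt (hV.mem_nhds hmV)
  have hdet : (a m).det ≠ 0 := by
    intro h0
    obtain ⟨v, hv0, hv⟩ := Matrix.exists_vecMul_eq_zero_iff.2 h0
    have : (nhdsWithin m ((V ∩ V') \ S)).NeBot :=
      hdense_open _ (hV.inter hV') (fun x hx => hVU hx.1) m ⟨hmV, hmV'⟩
    have hvb : Matrix.vecMul v (b m) = 0 := by
      refine Matrix.vecMul_eq_zero_of_tendsto_of_bounded (M := fun x => Matrix.of (ω x)) (C := C)
        (l := nhdsWithin m ((V ∩ V') \ S)) ((htendsto hsa).mono_left nhdsWithin_le_nhds)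
        ((htendsto hsb).mono_left nhdsWithin_le_nhds) ?_ ?_ hv
      · filter_upwards [self_mem_nhdsWithin] with x hx using hC x ⟨hx.1.2, hx.2⟩
      · filter_upwards [self_mem_nhdsWithin] with x hx using hgraph x ⟨hx.1.1, hx.2⟩
    refine hv0 (funext (Fintype.linearIndependent_iff.1 (hli m hmV) v (Prod.ext ?_ ?_)))
    · ext j
      simpa [ha, Matrix.vecMul, dotProduct, Prod.fst_sum] using congrFun hv j
    · ext j
      simpa [hb, Matrix.vecMul, dotProduct, Prod.snd_sum] using congrFun hvb j
  set W : Set (Fin n → ℝ) := V ∩ {x | (a x).det ≠ 0} with hWdef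
  have hW : IsOpen W :=
    (ContDiffOn.matrix_det hsa).continuousOn.isOpen_inter_preimage hV isOpen_ne
  have hWU : W ⊆ U := fun x hx => hVU hx.1
  have hsmooth : ∀ i j, ContDiffOn ℝ (⊤ : ℕ∞) (fun x => ((a x)⁻¹ * b x) i j) W := by
    intro i j
    simp only [Matrix.mul_apply]
    exact ContDiffOn.sum fun p _ =>
      (ContDiffOn.matrix_inv (fun i j => (hsa i j).mono Set.inter_subset_left)
        (fun x hx => hx.2) i p).mul ((hsb p j).mono Set.inter_subset_left)
  have hext : ∀ x ∈ W \ S, (a x)⁻¹ * b x = Matrix.of (ω x) := by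
    intro x hx
    rw [hgraph x ⟨hx.1.1, hx.2⟩, Matrix.nonsing_inv_mul_cancel_left _ _ (isUnit_iff_ne_zero.2 hx.1.2)]
  refine hsing ⟨W, fun x => (a x)⁻¹ * b x, hW, ⟨hmV, hdet⟩, hWU,
    contDiffOn_pi.2 fun i => contDiffOn_pi.2 fun j => hsmooth i j, ?_, hext⟩
  intro x hx i j
  have := hdense_open W hW hWU x hx
  have hlim : ∀ i j, Filter.Tendsto (fun y => ((a y)⁻¹ * b y) i j) (nhdsWithin x (W \ S))
      (nhds (((a x)⁻¹ * b x) i j)) := fun i j =>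
    ((hsmooth i j).continuousOn x hx).mono_left (nhdsWithin_mono x Set.sdiff_subset)
  refine tendsto_nhds_unique (hlim i j) ((hlim j i).neg.congr' ?_)
  filter_upwards [self_mem_nhdsWithin] with y hy
  rw [hext y hy]
  exact (hω.2 y ⟨hWU hy.1, hy.2⟩ i j).symm

end
end

section
/- Let ω be a closed singular 2-form on U∖S and m ∈ S. Suppose that on some open neighborhood W ⊆ U of m one can write ω = ω_reg + ω_sing on W∖S, where ω_reg : W∖S → alternating bilinear forms on ℝⁿ extends to a smooth map on all of W and ω_sing : W∖S → alternating bilinear forms on ℝⁿ is smooth. Then the singularity of ω at m is removable if and only if the singularity of ω_sing at m is removable. -/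
noncomputable section

/-- The gauge transformation `(X, α) ↦ (X, α + B(X,·))` of `ℝⁿ × (ℝⁿ)*`. -/
def gaugeEquiv {n : ℕ} (B : Fin n → Fin n → ℝ) :
    ((Fin n → ℝ) × (Fin n → ℝ)) ≃ₗ[ℝ] ((Fin n → ℝ) × (Fin n → ℝ)) :=
  LinearEquiv.skewProd (.refl ℝ _) (.refl ℝ _) (covecMap B)

theorem gaugeEquiv_apply {n : ℕ} (B : Fin n → Fin n → ℝ) (p : (Fin n → ℝ) × (Fin n → ℝ)) :
    gaugeEquiv B p = (p.1, p.2 + covecMap B p.1) := rfl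

theorem covecMap_apply {n : ℕ} (A : Fin n → Fin n → ℝ) (v : Fin n → ℝ) (j : Fin n) :
    covecMap A v j = ∑ i, v i * A i j := rfl

theorem covecMap_add {n : ℕ} (A B : Fin n → Fin n → ℝ) :
    covecMap (A + B) = covecMap A + covecMap B := by
  refine LinearMap.ext fun v => funext fun j => ?_
  simp [covecMap_apply, mul_add, Finset.sum_add_distrib]

/-- A gauge transformation by `B` carries the graph of `A` to the graph of `A + B`. -/
theorem map_gaugeEquiv_graphForm {n : ℕ} (A B : Fin n → Fin n → ℝ) :
    (graphForm A).map (gaugeEquiv B : _ →ₗ[ℝ] _) = graphForm (A + B) := by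
  ext ⟨X, α⟩
  simp only [graphForm, Submodule.mem_map, LinearMap.mem_graph_iff, covecMap_add,
    LinearEquiv.coe_coe, gaugeEquiv_apply, LinearMap.add_apply, Prod.mk.injEq]
  constructor
  · rintro ⟨p, hp, rfl, rfl⟩
    rw [hp]
  · rintro rfl
    exact ⟨(X, covecMap A X), rfl, rfl, rfl⟩

theorem contDiffOn_gaugeEquiv {n : ℕ} {k : WithTop ℕ∞} {V : Set (Fin n → ℝ)}
    {B : (Fin n → ℝ) → Fin n → Fin n → ℝ} {s : (Fin n → ℝ) → (Fin n → ℝ) × (Fin n → ℝ)}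
    (hB : ContDiffOn ℝ k B V) (hs : ContDiffOn ℝ k s V) :
    ContDiffOn ℝ k (fun x => gaugeEquiv (B x) (s x)) V := by
  refine hs.fst.prodMk (hs.snd.add (contDiffOn_pi.2 fun j => ?_))
  change ContDiffOn ℝ k (fun x => ∑ i, (s x).1 i * B x i j) V
  exact ContDiffOn.sum fun i _ =>
    (contDiffOn_pi.1 hs.fst i).mul (contDiffOn_pi.1 (contDiffOn_pi.1 hB i) j)

/-- Removability of a singularity is stable under adding a smooth bilinear form. -/
theorem RemovableAt.add {n : ℕ} {U W S : Set (Fin n → ℝ)}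
    {ω ω' B : (Fin n → ℝ) → Fin n → Fin n → ℝ} {m : Fin n → ℝ} {O : Set (Fin n → ℝ)}
    (h : RemovableAt U S ω m) (hO : IsOpen O) (hmO : m ∈ O) (hOW : O ⊆ W)
    (hB : ContDiffOn ℝ (⊤ : ℕ∞) B O) (hω' : ∀ x ∈ O \ S, ω' x = ω x + B x) :
    RemovableAt W S ω' m := by
  obtain ⟨V, s, hV, hmV, -, hs, hli, hspan⟩ := h
  refine ⟨V ∩ O, fun i x => gaugeEquiv (B x) (s i x), hV.inter hO, ⟨hmV, hmO⟩,
    fun x hx => hOW hx.2, fun i => ?_, fun x hx => ?_, fun x hx => ?_⟩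
  · exact contDiffOn_gaugeEquiv (hB.mono Set.inter_subset_right)
      ((hs i).mono Set.inter_subset_left)
  · exact (hli x hx.1).map_injOn (gaugeEquiv (B x)).toLinearMap (gaugeEquiv (B x)).injective.injOn
  · rw [hω' x ⟨hx.1.2, hx.2⟩, ← map_gaugeEquiv_graphForm, ← hspan x ⟨hx.1.1, hx.2⟩,
      Submodule.map_span, ← Set.range_comp]
    rfl

/-- (Cor. `SplitRemove`.)  Suppose that near `m ∈ S` the closed
singular 2-form `ω` splits as `ω = ω_reg + ω_sing` on `W∖S`, where `ω_reg` extends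
smoothly (with alternating values) to all of `W` and `ω_sing` is a singular 2-form
on `W∖S`.  Then the singularity of `ω` at `m` is removable iff the singularity of
`ω_sing` at `m` is removable. -/
theorem stmt_15 {n : ℕ} (hn : 2 ≤ n) (U S : Set (Fin n → ℝ))
    (hU : IsOpen U) (hSU : S ⊆ U) (hUS : IsOpen (U \ S)) (hdense : U ⊆ closure (U \ S))
    (ω : (Fin n → ℝ) → Fin n → Fin n → ℝ)
    (hω : IsSingularTwoForm U S ω) (hcl : IsClosedTwoFormOn ω (U \ S))
    (m : Fin n → ℝ) (hm : m ∈ S)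
    (W : Set (Fin n → ℝ)) (hW : IsOpen W) (hmW : m ∈ W) (hWU : W ⊆ U)
    (ωreg ωsing : (Fin n → ℝ) → Fin n → Fin n → ℝ)
    (hsplit : ∀ x ∈ W \ S, ω x = ωreg x + ωsing x)
    (hreg : ContDiffOn ℝ (⊤ : ℕ∞) ωreg W)
    (hregalt : ∀ x ∈ W, ∀ i j, ωreg x i j = - ωreg x j i)
    (hsingsm : ContDiffOn ℝ (⊤ : ℕ∞) ωsing (W \ S))
    (hsingalt : ∀ x ∈ W \ S, ∀ i j, ωsing x i j = - ωsing x j i) :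
    RemovableAt U S ω m ↔ RemovableAt W S ωsing m := by
  constructor
  · intro h
    refine h.add hW hmW subset_rfl hreg.neg fun x hx => ?_
    rw [hsplit x hx]
    simp
  · intro h
    refine h.add hW hmW hWU hreg fun x hx => ?_
    rw [hsplit x hx, add_comm]

end
end

section
/- Let U ⊆ ℝⁿ be open, m ∈ U, and α = (α₁, …, αₙ) : U → ℝⁿ a smooth map with α₁ ≡ 0 on U. Let K ⊆ {2, …, n} be a set of indices such that α_k ≡ 0 on U for every k ∈ K. Then there exist an open neighborhood V ⊆ U of m and a smooth map γ = (γ₁, …, γₙ) : V → ℝⁿ such that the functions ω_{ij} := ∂_i γ_j − ∂_j γ_i on V satisfy: (a) ω_{1j} = α_j on V for every j; (b) ω_{kl} ≡ 0 on V for all k, l ∈ K; and (c) if α(m) = 0 then ω_{ij}(m) = 0 for all i, j. -/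
open intervalIntegral in
theorem hasFDerivAt_intervalIntegral_of_contDiff {E F : Type*} [NormedAddCommGroup E]
    [NormedSpace ℝ E] [ProperSpace E] [NormedAddCommGroup F] [NormedSpace ℝ F]
    {f : E × ℝ → F} (hf : ContDiff ℝ 1 f) (a b : ℝ) (x : E) :
    HasFDerivAt (fun y => ∫ t in a..b, f (y, t))
      (∫ t in a..b, (fderiv ℝ f (x, t)).comp (ContinuousLinearMap.inl ℝ E ℝ)) x := by
  have hf' : Continuous fun p : E × ℝ =>
      (fderiv ℝ f p).comp (ContinuousLinearMap.inl ℝ E ℝ) :=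
    (hf.continuous_fderiv one_ne_zero).clm_comp continuous_const
  obtain ⟨C, hC⟩ := ((isCompact_closedBall x 1).prod (isCompact_uIcc (a := a) (b := b)))
    |>.exists_bound_of_continuousOn hf'.continuousOn
  refine (hasFDerivAt_integral_of_dominated_of_fderiv_le (𝕜 := ℝ) (μ := MeasureTheory.volume)
    (s := Metric.closedBall x 1) (bound := fun _ => C)
    (F' := fun y t => (fderiv ℝ f (y, t)).comp (ContinuousLinearMap.inl ℝ E ℝ))
    (Metric.closedBall_mem_nhds x one_pos) ?_ ?_ ?_ ?_ ?_ ?_)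
  · exact .of_forall fun y => (hf.continuous.comp (by fun_prop)).aestronglyMeasurable
  · exact (hf.continuous.comp (by fun_prop)).intervalIntegrable _ _
  · exact (hf'.comp (by fun_prop : Continuous fun t : ℝ => (x, t))).aestronglyMeasurable
  · exact .of_forall fun t ht y hy => hC (y, t) ⟨hy, Set.uIoc_subset_uIcc ht⟩
  · exact intervalIntegrable_const
  · exact .of_forall fun t _ y _ =>
      ((hf.differentiable one_ne_zero).differentiableAt.hasFDerivAt).comp y
        (hasFDerivAt_prodMk_left y t)

theorem contDiff_nat_intervalIntegral {E F : Type} [NormedAddCommGroup E]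
    [NormedSpace ℝ E] [ProperSpace E] [NormedAddCommGroup F] [NormedSpace ℝ F]
    (k : ℕ) {f : E × ℝ → F} (hf : ContDiff ℝ k f) (a b : ℝ) :
    ContDiff ℝ k fun y => ∫ t in a..b, f (y, t) := by
  induction k generalizing F with
  | zero =>
    exact contDiff_zero.2 <|
      intervalIntegral.continuous_parametric_intervalIntegral_of_continuous'
        (f := fun y t => f (y, t)) hf.continuous a b
  | succ k ih =>
    have hd := hasFDerivAt_intervalIntegral_of_contDiff (hf.of_le (by simp)) a b
    push_cast at hf ⊢
    refine contDiff_succ_iff_fderiv.2 ⟨fun x => (hd x).differentiableAt, by simp, ?_⟩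
    rw [funext fun x => (hd x).fderiv]
    exact ih (f := fun p => (fderiv ℝ f p).comp (ContinuousLinearMap.inl ℝ E ℝ))
      ((hf.fderiv_right le_rfl).clm_comp contDiff_const)

theorem fderiv_apply_eq_of_hasDerivAt_line {E F : Type*} [NormedAddCommGroup E]
    [NormedSpace ℝ E] [NormedAddCommGroup F] [NormedSpace ℝ F] {f : E → F} {x v : E} {d : F}
    (hf : DifferentiableAt ℝ f x) (hd : HasDerivAt (fun s : ℝ => f (x + s • v)) d 0) :
    fderiv ℝ f x v = d :=
  hf.lineDeriv_eq_fderiv.symm.trans hd.deriv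

section PartialPrimitive

variable {ι F : Type} [Fintype ι] [DecidableEq ι] [NormedAddCommGroup F] [NormedSpace ℝ F]
  {A : (ι → ℝ) → F}

theorem contDiff_integral_update (hA : ContDiff ℝ (⊤ : ℕ∞) A) (i : ι) (a : ℝ) :
    ContDiff ℝ (⊤ : ℕ∞) fun y : ι → ℝ => ∫ t in a..y i, A (Function.update y i t) := by
  have hrescale : (fun y : ι → ℝ => ∫ t in a..y i, A (Function.update y i t)) =
      fun y => (y i - a) • ∫ s in (0 : ℝ)..1, A (Function.update y i ((y i - a) * s + a)) := by
    funext y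
    rw [intervalIntegral.smul_integral_comp_mul_add (fun t => A (Function.update y i t))]
    simp
  have hupdate : ContDiff ℝ (⊤ : ℕ∞) fun p : (ι → ℝ) × ℝ =>
      Function.update p.1 i ((p.1 i - a) * p.2 + a) := by
    refine contDiff_pi.2 fun j => ?_
    rcases eq_or_ne j i with rfl | hj
    · simp only [Function.update_self]
      fun_prop
    · simp only [Function.update_of_ne hj]
      fun_prop
  rw [hrescale]
  refine ContDiff.smul (by fun_prop) (contDiff_infty.2 fun k => ?_)
  exact contDiff_nat_intervalIntegral k (contDiff_infty.1 (hA.comp hupdate) k) 0 1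

theorem fderiv_integral_update_single_self [CompleteSpace F] (hA : ContDiff ℝ (⊤ : ℕ∞) A)
    (i : ι) (a : ℝ) (x : ι → ℝ) :
    fderiv ℝ (fun y : ι → ℝ => ∫ t in a..y i, A (Function.update y i t)) x (Pi.single i 1) =
      A x := by
  refine fderiv_apply_eq_of_hasDerivAt_line
    ((contDiff_integral_update hA i a).differentiable (by simp)).differentiableAt ?_
  have hupd : ∀ s t : ℝ,
      Function.update (x + s • Pi.single i (1 : ℝ)) i t = Function.update x i t := by
    intro s t
    ext j
    rcases eq_or_ne j i with rfl | hj <;> simp [*]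
  have hc : Continuous fun t => A (Function.update x i t) :=
    hA.continuous.comp (by fun_prop)
  have hftc := hc.integral_hasStrictDerivAt a (x i) |>.hasDerivAt
  rw [Function.update_eq_self] at hftc
  simp only [hupd, Pi.add_apply, Pi.smul_apply, Pi.single_eq_same, smul_eq_mul, mul_one]
  rw [← add_zero (x i)] at hftc
  exact hftc.comp_const_add (x i) 0

theorem fderiv_integral_update_single_of_ne (hA : ContDiff ℝ (⊤ : ℕ∞) A)
    {i j : ι} (hij : j ≠ i) (x : ι → ℝ) :
    fderiv ℝ (fun y : ι → ℝ => ∫ t in x i..y i, A (Function.update y i t)) x (Pi.single j 1) =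
      0 := by
  refine fderiv_apply_eq_of_hasDerivAt_line
    ((contDiff_integral_update hA i (x i)).differentiable (by simp)).differentiableAt ?_
  simpa [hij.symm] using hasDerivAt_const (0 : ℝ) (0 : F)

end PartialPrimitive

theorem exists_contDiff_eqOn_ball {E F : Type*} [NormedAddCommGroup E] [NormedSpace ℝ E]
    [FiniteDimensional ℝ E] [NormedAddCommGroup F] [NormedSpace ℝ F] {f : E → F} {U : Set E}
    {m : E} (hU : IsOpen U) (hm : m ∈ U) (hf : ContDiffOn ℝ (⊤ : ℕ∞) f U) :
    ∃ (g : E → F) (r : ℝ), 0 < r ∧ Metric.ball m r ⊆ U ∧ ContDiff ℝ (⊤ : ℕ∞) g ∧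
      ∀ x ∈ Metric.ball m r, g x = f x := by
  obtain ⟨R, hR, hRU⟩ := Metric.nhds_basis_closedBall.mem_iff.1 (hU.mem_nhds hm)
  let β : ContDiffBump m := ⟨R / 2, R, half_pos hR, half_lt_self hR⟩
  refine ⟨fun x => β x • f x, R / 2, half_pos hR,
    (Metric.ball_subset_ball (half_le_self hR.le)).trans (Metric.ball_subset_closedBall.trans hRU),
    contDiff_iff_contDiffAt.2 fun x => ?_, fun x hx => ?_⟩
  · by_cases hx : x ∈ Metric.closedBall m R
    · exact β.contDiffAt.smul (hf.contDiffAt (hU.mem_nhds (hRU hx)))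
    · refine contDiffAt_const (c := (0 : F)) |>.congr_of_eventuallyEq ?_
      filter_upwards [Metric.isClosed_closedBall.isOpen_compl.mem_nhds hx] with y hy
      have : R ≤ dist y m := (not_le.1 fun h => hy (Metric.mem_closedBall.2 h)).le
      simp [β.zero_of_le_dist this]
  · simp [β.one_of_mem_closedBall (Metric.ball_subset_closedBall hx)]


/-- (Coordinate form of the key lemma.)  Let `α : U → ℝⁿ` be a
smooth map on an open set `U ∋ m` whose first component vanishes identically, and
let `K` be a set of coordinate indices not containing the first one such that
`α_k ≡ 0` for `k ∈ K`.  Then near `m` there is a smooth `γ : V → ℝⁿ` such that the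
closed 2-form `ω_{ij} = ∂_i γ_j - ∂_j γ_i` satisfies `ω_{1j} = α_j`, `ω_{kl} = 0`
for `k, l ∈ K`, and `ω(m) = 0` whenever `α(m) = 0`.  (Indices are `0`-based: the
statement's index `1` is `0 : Fin n`.) -/
theorem stmt_18 {n : ℕ} [NeZero n] (U : Set (Fin n → ℝ)) (hU : IsOpen U)
    (m : Fin n → ℝ) (hm : m ∈ U)
    (α : (Fin n → ℝ) → Fin n → ℝ) (hα : ContDiffOn ℝ (⊤ : ℕ∞) α U)
    (hα0 : ∀ x ∈ U, α x 0 = 0)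
    (K : Set (Fin n)) (hK0 : (0 : Fin n) ∉ K)
    (hαK : ∀ k ∈ K, ∀ x ∈ U, α x k = 0) :
    ∃ (V : Set (Fin n → ℝ)) (γ : (Fin n → ℝ) → Fin n → ℝ),
      IsOpen V ∧ m ∈ V ∧ V ⊆ U ∧ ContDiffOn ℝ (⊤ : ℕ∞) γ V ∧
      (∀ x ∈ V, ∀ j : Fin n,
        fderiv ℝ (fun y => γ y j) x (Pi.single 0 1) -
          fderiv ℝ (fun y => γ y 0) x (Pi.single j 1) = α x j) ∧
      (∀ k ∈ K, ∀ l ∈ K, ∀ x ∈ V,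
        fderiv ℝ (fun y => γ y l) x (Pi.single k 1) -
          fderiv ℝ (fun y => γ y k) x (Pi.single l 1) = 0) ∧
      (α m = 0 → ∀ i j : Fin n,
        fderiv ℝ (fun y => γ y j) m (Pi.single i 1) -
          fderiv ℝ (fun y => γ y i) m (Pi.single j 1) = 0) := by
  obtain ⟨A, r, hr, hrU, hA, hAα⟩ := exists_contDiff_eqOn_ball hU hm hα
  set γ : (Fin n → ℝ) → Fin n → ℝ :=
    fun y => ∫ t in m 0..y 0, A (Function.update y 0 t) with hγ_def
  have hγ : ContDiff ℝ (⊤ : ℕ∞) γ := contDiff_integral_update hA 0 (m 0)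
  have hcoord : ∀ x v j, fderiv ℝ (fun y => γ y j) x v = fderiv ℝ γ x v j := fun x v j => by
    rw [fderiv_apply (hγ.differentiable (by simp)).differentiableAt]
    rfl
  have hzero : ∀ j, (∀ x ∈ U, α x j = 0) → ∀ x ∈ Metric.ball m r, ∀ v,
      fderiv ℝ (fun y => γ y j) x v = 0 := by
    intro j hj x hx v
    have hγj : (fun y => γ y j) =ᶠ[nhds x] fun _ => 0 := by
      filter_upwards [Metric.isOpen_ball.mem_nhds hx] with y hy
      have hint : IntervalIntegrable (fun t => A (Function.update y 0 t)) MeasureTheory.volume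
          (m 0) (y 0) :=
        (hA.continuous.comp (by fun_prop)).intervalIntegrable _ _
      have happly :=
        (ContinuousLinearMap.proj (R := ℝ) (φ := fun _ : Fin n => ℝ) j).intervalIntegral_comp_comm
          hint
      refine happly.symm.trans (intervalIntegral.integral_zero_ae (.of_forall fun t ht => ?_))
      have hmem : Function.update y 0 t ∈ Metric.ball m r := by
        refine (dist_pi_lt_iff hr).2 fun i => ?_
        rcases eq_or_ne i 0 with rfl | hi
        · rw [Function.update_self]
          have hle := Set.abs_sub_left_of_mem_uIcc (Set.uIoc_subset_uIcc ht)
          rw [Real.dist_eq]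
          exact hle.trans_lt (by simpa [Real.dist_eq] using (dist_pi_lt_iff hr).1 hy 0)
        · rw [Function.update_of_ne hi]
          exact (dist_pi_lt_iff hr).1 hy i
      exact (congrFun (hAα _ hmem) j).trans (hj _ (hrU hmem))
    rw [hγj.fderiv_eq]
    simp
  have hmball := Metric.mem_ball_self (x := m) hr
  refine ⟨Metric.ball m r, γ, Metric.isOpen_ball, hmball, hrU, hγ.contDiffOn,
    fun x hx j => ?_, fun k hk l hl x hx => ?_, fun hαm i j => ?_⟩
  · rw [hzero 0 hα0 x hx, hcoord, hγ_def, fderiv_integral_update_single_self hA, hAα x hx, sub_zero]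
  · rw [hzero l (hαK l hl) x hx, hzero k (hαK k hk) x hx, sub_zero]
  · have hγm : ∀ i, fderiv ℝ γ m (Pi.single i 1) = 0 := by
      intro i
      rcases eq_or_ne i 0 with rfl | hi
      · rw [hγ_def, fderiv_integral_update_single_self hA, hAα m hmball, hαm]
      · exact fderiv_integral_update_single_of_ne hA hi m
    simp [hcoord, hγm]
end
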